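/- arXiv:math/0605066 — 2 statements merged into one kernel-verified Lean document; each statement's English description precedes it below -/
import Mathlib

section
/- (Theorem 1.) Let U ⊆ ℂ² be a polydisc centered at 0, W = (ω_1,…,ω_k) a k-web on U, and X = (P,Q) a transverse infinitesimal automorphism of W with X(0) ≠ (0,0). Set ω_{k+1} := (−Q,P) and let W ⊠ F_X be the (k+1)-web (ω_1,…,ω_k,ω_{k+1}). Assume the spaces of abelian relations A(W) and A(W ⊠ F_X) (spaces of germs at 0) are finite-dimensional ℂ-vector spaces (this holds automatically by Bol's theorem). Then dim_ℂ A(W ⊠ F_X) = dim_ℂ A(W) + (k − 1). -/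
open Complex Filter Topology

noncomputable section

/-- A point of the complex plane `ℂ²`. -/
abbrev Pt : Type := ℂ × ℂ

/-- A (holomorphic) 1-form `A dx + B dy` on (an open subset of) `ℂ²`,
identified with the pair of functions `(A, B)`. -/
abbrev Form1 : Type := (Pt → ℂ) × (Pt → ℂ)

/-- The complex partial derivative `∂f/∂x`. -/
noncomputable def pdx (f : Pt → ℂ) (p : Pt) : ℂ := fderiv ℂ f p (1, 0)

/-- The complex partial derivative `∂f/∂y`. -/
noncomputable def pdy (f : Pt → ℂ) (p : Pt) : ℂ := fderiv ℂ f p (0, 1)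

/-- The derivative `X(f) = P ∂f/∂x + Q ∂f/∂y` of `f` along the vector field `X = (P, Q)`. -/
noncomputable def Xf (P Q f : Pt → ℂ) (p : Pt) : ℂ := P p * pdx f p + Q p * pdy f p

/-- The contraction `i_X ω = A·P + B·Q` of the 1-form `ω = (A,B)` with `X = (P,Q)`. -/
noncomputable def contr (P Q : Pt → ℂ) (ω : Form1) (p : Pt) : ℂ := ω.1 p * P p + ω.2 p * Q p

/-- The wedge `ω ∧ ω' = A·B' − B·A'` of two 1-forms, as a function. -/
noncomputable def wedge (ω ω' : Form1) (p : Pt) : ℂ := ω.1 p * ω'.2 p - ω.2 p * ω'.1 p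

/-- The differential `df = (∂f/∂x, ∂f/∂y)` of a function. -/
noncomputable def fd (f : Pt → ℂ) : Form1 := (pdx f, pdy f)

/-- A 1-form `(A,B)` is closed on `U` if `∂A/∂y = ∂B/∂x` on `U`. -/
def IsClosedOn (ω : Form1) (U : Set Pt) : Prop := ∀ p ∈ U, pdy ω.1 p = pdx ω.2 p

/-- The Lie derivative `L_X ω` of the 1-form `ω = (A,B)` with respect to `X = (P,Q)`:
`L_X ω = (X(A) + A ∂P/∂x + B ∂Q/∂x, X(B) + A ∂P/∂y + B ∂Q/∂y)`. -/
noncomputable def lie (P Q : Pt → ℂ) (ω : Form1) : Form1 :=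
  (fun p => Xf P Q ω.1 p + ω.1 p * pdx P p + ω.2 p * pdx Q p,
   fun p => Xf P Q ω.2 p + ω.1 p * pdy P p + ω.2 p * pdy Q p)

/-- A 1-form is holomorphic on `U` if both its components are. -/
def AnalyticForm (ω : Form1) (U : Set Pt) : Prop :=
  AnalyticOnNhd ℂ ω.1 U ∧ AnalyticOnNhd ℂ ω.2 U
/-- A `k`-web on `U`: a `k`-tuple of holomorphic 1-forms, each nonvanishing on `U`,
pairwise transverse at the origin. -/
structure IsWeb {k : ℕ} (ω : Fin k → Form1) (U : Set Pt) : Prop where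
  analytic : ∀ i, AnalyticForm (ω i) U
  nonvanishing : ∀ i, ∀ p ∈ U, ((ω i).1 p, (ω i).2 p) ≠ (0, 0)
  transverse : ∀ i j, i ≠ j → wedge (ω i) (ω j) 0 ≠ 0

/-- An abelian relation `(η_1, …, η_k)` on `V` of the web given by `(ω_1, …, ω_k)`. -/
structure IsAbelianRelOn {k : ℕ} (ω : Fin k → Form1) (η : Fin k → Form1) (V : Set Pt) :
    Prop where
  analytic : ∀ i, AnalyticForm (η i) V
  closed : ∀ i, IsClosedOn (η i) V
  tangent : ∀ i, ∀ p ∈ V, wedge (η i) (ω i) p = 0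
  sum_fst : ∀ p ∈ V, ∑ i, (η i).1 p = 0
  sum_snd : ∀ p ∈ V, ∑ i, (η i).2 p = 0

/-- `U` is a polydisc centered at the origin. -/
def IsPolydisc (U : Set Pt) : Prop :=
  ∃ r s : ℝ, 0 < r ∧ 0 < s ∧ U = Metric.ball (0 : ℂ) r ×ˢ Metric.ball (0 : ℂ) s

/-- `X = (P,Q)` is an infinitesimal automorphism of the web `(ω_1, …, ω_k)` on `U`:
`(L_X ω_i) ∧ ω_i = 0` on `U` for all `i`. -/
def IsInfAut (P Q : Pt → ℂ) {k : ℕ} (ω : Fin k → Form1) (U : Set Pt) : Prop :=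
  ∀ i, ∀ p ∈ U, wedge (lie P Q (ω i)) (ω i) p = 0

/-- `X = (P,Q)` is transverse to the web `(ω_1, …, ω_k)` on `U`:
`i_X ω_i` is nonvanishing on `U` for all `i`. -/
def IsTransverseTo (P Q : Pt → ℂ) {k : ℕ} (ω : Fin k → Form1) (U : Set Pt) : Prop :=
  ∀ i, ∀ p ∈ U, contr P Q (ω i) p ≠ 0

/-- `u` is the canonical first integral of the 1-form `ω` with respect to `X = (P,Q)` on `U`:
`u` is holomorphic, `u(0) = 0` and `du = ω / (i_X ω)`. -/
def IsCanonicalFI (P Q : Pt → ℂ) (ω : Form1) (u : Pt → ℂ) (U : Set Pt) : Prop :=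
  AnalyticOnNhd ℂ u U ∧ u 0 = 0 ∧
    ∀ p ∈ U, pdx u p = ω.1 p / contr P Q ω p ∧ pdy u p = ω.2 p / contr P Q ω p

/-- Germs at the origin of `ℂ`-valued functions on `ℂ²`. -/
abbrev GermC : Type := Filter.Germ (𝓝 (0 : Pt)) ℂ

/-- The set of germs at `0` of abelian relations of the web `(ω_1,…,ω_k)` (defined on
`U`): tuples of germs of holomorphic 1-forms admitting representatives that form an
abelian relation on some neighborhood of `0` contained in `U`.  Its `ℂ`-span in the space
of tuples of germs is the space of abelian relations `A(W)` (the set itself is a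
`ℂ`-subspace, so taking the span is harmless). -/
def ARGerms {k : ℕ} (U : Set Pt) (ω : Fin k → Form1) : Set (Fin k → GermC × GermC) :=
  {η | ∃ V ∈ 𝓝 (0 : Pt), V ⊆ U ∧ ∃ a : Fin k → Form1,
      (∀ i, (η i).1 = ((a i).1 : GermC) ∧ (η i).2 = ((a i).2 : GermC)) ∧
      IsAbelianRelOn ω a V}

section AbelianRelations

variable {R : Type*} [CommRing R] [Algebra ℂ R]

/-- The space of abelian relations of a tuple `W` of 1-forms over a ring with two derivations. -/
def abelianRel (dx dy : Derivation ℂ R R) {k : ℕ} (W : Fin k → R × R) :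
    Submodule ℂ (Fin k → R × R) where
  carrier := {η | (∀ i, dy (η i).1 = dx (η i).2) ∧
    (∀ i, (η i).1 * (W i).2 = (η i).2 * (W i).1) ∧ ∑ i, η i = 0}
  zero_mem' := by simp
  add_mem' := by
    rintro a b ⟨ha, ha', ha''⟩ ⟨hb, hb', hb''⟩
    refine ⟨fun i => ?_, fun i => ?_, ?_⟩
    · simp [ha i, hb i]
    · simp [add_mul, ha' i, hb' i]
    · simp [Finset.sum_add_distrib, ha'', hb'']
  smul_mem' := by
    rintro c a ⟨ha, ha', ha''⟩
    refine ⟨fun i => ?_, fun i => ?_, ?_⟩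
    · simp [ha i]
    · simp [ha' i]
    · simp [← Finset.smul_sum, ha'']

/-- The contraction of 1-forms with the vector field `(P, Q)`, as a linear map. -/
def contraction (P Q : R) : R × R →ₗ[ℂ] R where
  toFun η := η.1 * P + η.2 * Q
  map_add' a b := by simp only [Prod.fst_add, Prod.snd_add]; ring
  map_smul' c a := by simp

@[simp] lemma contraction_apply (P Q : R) (η : R × R) :
    contraction P Q η = η.1 * P + η.2 * Q := rfl

/-- The differential of the contraction with `(P, Q)`; on closed 1-forms this is the
Lie derivative. -/
def dContraction (dx dy : Derivation ℂ R R) (P Q : R) : R × R →ₗ[ℂ] R × R :=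
  (dx.toLinearMap.prod dy.toLinearMap) ∘ₗ contraction P Q

@[simp] lemma dContraction_apply (dx dy : Derivation ℂ R R) (P Q : R) (η : R × R) :
    dContraction dx dy P Q η = (dx (contraction P Q η), dy (contraction P Q η)) := rfl

/-- The differential of the contraction, applied to all the forms of a tuple but the last. -/
def dContractionInit (dx dy : Derivation ℂ R R) (P Q : R) (k : ℕ) :
    (Fin (k + 1) → R × R) →ₗ[ℂ] (Fin k → R × R) :=
  LinearMap.pi fun i => dContraction dx dy P Q ∘ₗ LinearMap.proj i.castSucc

@[simp] lemma dContractionInit_apply (dx dy : Derivation ℂ R R) (P Q : R) {k : ℕ}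
    (η : Fin (k + 1) → R × R) (i : Fin k) :
    dContractionInit dx dy P Q k η i = dContraction dx dy P Q (η i.castSucc) := rfl

/-- The tuple `(h₁ θ₁, …, h_k θ_k, -∑ h_i θ_i)`. -/
def snocNegSum {k : ℕ} (θ : Fin k → R × R) (h : Fin k → R) : Fin (k + 1) → R × R :=
  Fin.snoc (fun i => h i • θ i) (-∑ i, h i • θ i)

lemma snocNegSum_mem (dx dy : Derivation ℂ R R) {P Q : R} {k : ℕ} {W θ : Fin k → R × R}
    (hθ : ∀ i, dy (θ i).1 = dx (θ i).2) (hθW : ∀ i, (θ i).1 * (W i).2 = (θ i).2 * (W i).1)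
    (hθ1 : ∀ i, contraction P Q (θ i) = 1) {h : Fin k → R}
    (hh : ∀ i, dy (h i) * (θ i).1 = dx (h i) * (θ i).2) (hs : ∑ i, h i = 0) :
    snocNegSum θ h ∈ abelianRel dx dy (Fin.snoc W (-Q, P) : Fin (k + 1) → R × R) := by
  have hc : ∀ i, dy (h i * (θ i).1) = dx (h i * (θ i).2) := fun i => by
    simp only [Derivation.leibniz, smul_eq_mul]
    linear_combination hh i + h i * hθ i
  refine ⟨fun i => ?_, fun i => ?_, ?_⟩
  · refine Fin.lastCases ?_ (fun i => ?_) i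
    · simp [snocNegSum, Prod.fst_sum, Prod.snd_sum, hc]
    · simpa [snocNegSum] using hc i
  · refine Fin.lastCases ?_ (fun i => ?_) i
    · have : ∑ i, h i * (θ i).1 * P = - ∑ i, h i * (θ i).2 * Q := by
        rw [← sub_eq_zero, sub_neg_eq_add, ← Finset.sum_add_distrib, ← hs]
        refine Finset.sum_congr rfl fun i _ => ?_
        have := hθ1 i
        rw [contraction_apply] at this
        linear_combination h i * this
      simp [snocNegSum, Prod.fst_sum, Prod.snd_sum, Finset.sum_mul, this]
    · simp [snocNegSum, mul_assoc, hθW i]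
  · simp [snocNegSum, Fin.sum_univ_castSucc]

lemma contraction_last_eq_zero {dx dy : Derivation ℂ R R} {P Q : R} {k : ℕ}
    {W : Fin k → R × R} {η : Fin (k + 1) → R × R}
    (hη : η ∈ abelianRel dx dy (Fin.snoc W (-Q, P) : Fin (k + 1) → R × R)) :
    contraction P Q (η (Fin.last k)) = 0 := by
  have := hη.2.1 (Fin.last k)
  simp only [Fin.snoc_last] at this
  rw [contraction_apply]
  linear_combination this

lemma sum_contraction_castSucc {dx dy : Derivation ℂ R R} {P Q : R} {k : ℕ}
    {W : Fin k → R × R} {η : Fin (k + 1) → R × R}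
    (hη : η ∈ abelianRel dx dy (Fin.snoc W (-Q, P) : Fin (k + 1) → R × R)) :
    ∑ i : Fin k, contraction P Q (η i.castSucc) = 0 := by
  have := congrArg (contraction P Q) hη.2.2
  rwa [map_sum, map_zero, Fin.sum_univ_castSucc, contraction_last_eq_zero hη, add_zero] at this

variable {dx dy : Derivation ℂ R R} {P Q : R} {k : ℕ} {W θ : Fin k → R × R}

lemma eq_contraction_smul (hW : ∀ i, IsUnit (contraction P Q (W i)))
    (hθW : ∀ i, (θ i).1 * (W i).2 = (θ i).2 * (W i).1)
    (hθ1 : ∀ i, contraction P Q (θ i) = 1) {i : Fin k} {η : R × R}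
    (h : η.1 * (W i).2 = η.2 * (W i).1) : η = contraction P Q η • θ i := by
  have h1 := hθ1 i
  rw [contraction_apply] at h1
  have h2 := hθW i
  ext
  · apply (hW i).mul_left_cancel
    simp only [contraction_apply, Prod.smul_fst, smul_eq_mul]
    linear_combination (-(η.1 * P + η.2 * Q) * (W i).1) * h1 + Q * h +
      (-(η.1 * P + η.2 * Q) * Q) * h2
  · apply (hW i).mul_left_cancel
    simp only [contraction_apply, Prod.smul_snd, smul_eq_mul]
    linear_combination (-(η.1 * P + η.2 * Q) * (W i).2) * h1 - P * h +
      ((η.1 * P + η.2 * Q) * P) * h2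

lemma map_dContractionInit_abelianRel
    (hcomm : ∀ f, dy (dx f) = dx (dy f))
    (hpoinc : ∀ a b, dy a = dx b → ∃ g, dx g = a ∧ dy g = b)
    (hconst : ∀ g, dx g = 0 → dy g = 0 → ∃ c : ℂ, g = algebraMap ℂ R c)
    (hW : ∀ i, IsUnit (contraction P Q (W i)))
    (hθ : ∀ i, dy (θ i).1 = dx (θ i).2) (hθW : ∀ i, (θ i).1 * (W i).2 = (θ i).2 * (W i).1)
    (hθ1 : ∀ i, contraction P Q (θ i) = 1) :
    (abelianRel dx dy (Fin.snoc W (-Q, P) : Fin (k + 1) → R × R)).map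
      (dContractionInit dx dy P Q k) = abelianRel dx dy W := by
  apply le_antisymm
  · rintro _ ⟨η, hη, rfl⟩
    refine ⟨fun i => ?_, fun i => ?_, ?_⟩
    · exact hcomm _
    · have h0 := hη.2.1 i.castSucc
      simp only [Fin.snoc_castSucc] at h0
      have h1 := eq_contraction_smul hW hθW hθ1 h0
      have h2 := hη.1 i.castSucc
      set h := contraction P Q (η i.castSucc) with hh
      rw [h1] at h2
      simp only [Prod.smul_fst, Prod.smul_snd, Derivation.leibniz, smul_eq_mul] at h2
      have h3 := eq_contraction_smul hW hθW hθ1 (mul_comm (W i).1 (W i).2)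
      rw [h3]
      simp only [dContractionInit_apply, dContraction_apply, ← hh, Prod.smul_fst, Prod.smul_snd,
        smul_eq_mul]
      linear_combination -(contraction P Q (W i)) * (h2 - h * hθ i)
    · have := sum_contraction_castSucc hη
      ext
      · simp only [Prod.fst_sum, dContractionInit_apply, dContraction_apply, ← map_sum, this]
        simp
      · simp only [Prod.snd_sum, dContractionInit_apply, dContraction_apply, ← map_sum, this]
        simp
  · intro η hη
    choose g hgx hgy using fun i => hpoinc _ _ (hη.1 i)
    obtain ⟨c, hc⟩ := hconst (∑ i, g i)
      (by simp only [map_sum, hgx]; rw [← Prod.fst_sum, hη.2.2]; rfl)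
      (by simp only [map_sum, hgy]; rw [← Prod.snd_sum, hη.2.2]; rfl)
    have hs : ∑ i, (g i - algebraMap ℂ R (c / k)) = 0 := by
      rcases k.eq_zero_or_pos with rfl | hk
      · simp
      · have hk' : (k : ℂ) ≠ 0 := by exact_mod_cast hk.ne'
        rw [Finset.sum_sub_distrib, hc, Finset.sum_const, Finset.card_univ, Fintype.card_fin,
          ← map_nsmul, nsmul_eq_mul, mul_div_cancel₀ _ hk', sub_self]
    refine ⟨snocNegSum θ fun i => g i - algebraMap ℂ R (c / k),
      snocNegSum_mem dx dy hθ hθW hθ1 (fun i => ?_) hs, ?_⟩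
    · have h1 := eq_contraction_smul hW hθW hθ1 (hη.2.1 i)
      have h2 := congrArg Prod.fst h1
      have h3 := congrArg Prod.snd h1
      simp only [Prod.smul_fst, Prod.smul_snd, smul_eq_mul] at h2 h3
      simp only [map_sub, Derivation.map_algebraMap, sub_zero, hgx, hgy]
      rw [h2, h3]
      ring
    · have h1 : ∀ i, contraction P Q ((g i - algebraMap ℂ R (c / k)) • θ i)
          = g i - algebraMap ℂ R (c / k) := fun i => by
        have := hθ1 i
        simp only [contraction_apply, Prod.smul_fst, Prod.smul_snd, smul_eq_mul] at this ⊢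
        linear_combination (g i - algebraMap ℂ R (c / k)) * this
      funext i
      rw [dContractionInit_apply, dContraction_apply, snocNegSum, Fin.snoc_castSucc, h1]
      simp [hgx, hgy]

/-- The linear map sending constants `c` to `(c₁ θ₁, …, c_k θ_k, -∑ c_i θ_i)`. -/
def constSnocNegSum (θ : Fin k → R × R) : (Fin k → ℂ) →ₗ[ℂ] (Fin (k + 1) → R × R) where
  toFun c := snocNegSum θ fun i => algebraMap ℂ R (c i)
  map_add' a b := by
    funext i
    refine Fin.lastCases ?_ (fun i => ?_) i
    · simp [snocNegSum, add_smul, Finset.sum_add_distrib, add_comm]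
    · simp [snocNegSum, add_smul]
  map_smul' a b := by
    funext i
    refine Fin.lastCases ?_ (fun i => ?_) i
    · simp [snocNegSum, mul_smul, Finset.smul_sum]
    · simp [snocNegSum, mul_smul]

/-- The sum of the coordinates, as a linear functional. -/
def coordSum (k : ℕ) : (Fin k → ℂ) →ₗ[ℂ] ℂ := ∑ i, LinearMap.proj i

lemma coordSum_apply (c : Fin k → ℂ) : coordSum k c = ∑ i, c i := by simp [coordSum]

lemma finrank_ker_coordSum (k : ℕ) :
    Module.finrank ℂ (LinearMap.ker (coordSum k)) = k - 1 := by
  have h := LinearMap.finrank_range_add_finrank_ker (coordSum k)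
  rw [Module.finrank_fin_fun] at h
  rcases k with _ | k
  · omega
  · have : LinearMap.range (coordSum (k + 1)) = ⊤ := by
      rw [LinearMap.range_eq_top]
      intro z
      exact ⟨Pi.single 0 z, by simp [coordSum_apply]⟩
    rw [this, finrank_top, Module.finrank_self] at h
    omega

lemma abelianRel_inf_ker_dContractionInit
    (hconst : ∀ g, dx g = 0 → dy g = 0 → ∃ c : ℂ, g = algebraMap ℂ R c)
    (hinj : Function.Injective (algebraMap ℂ R))
    (hW : ∀ i, IsUnit (contraction P Q (W i)))
    (hθ : ∀ i, dy (θ i).1 = dx (θ i).2) (hθW : ∀ i, (θ i).1 * (W i).2 = (θ i).2 * (W i).1)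
    (hθ1 : ∀ i, contraction P Q (θ i) = 1) :
    abelianRel dx dy (Fin.snoc W (-Q, P) : Fin (k + 1) → R × R) ⊓
      LinearMap.ker (dContractionInit dx dy P Q k) =
    (LinearMap.ker (coordSum k)).map (constSnocNegSum θ) := by
  have key : ∀ (r : R) i, contraction P Q (r • θ i) = r := fun r i => by
    have := hθ1 i
    simp only [contraction_apply, Prod.smul_fst, Prod.smul_snd, smul_eq_mul] at this ⊢
    linear_combination r * this
  apply le_antisymm
  · rintro η ⟨hη, hker⟩
    have hker' : ∀ i : Fin k, dx (contraction P Q (η i.castSucc)) = 0 ∧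
        dy (contraction P Q (η i.castSucc)) = 0 := fun i => by
      have := congrFun (LinearMap.mem_ker.1 hker) i
      exact ⟨congrArg Prod.fst this, congrArg Prod.snd this⟩
    choose c hc using fun i => hconst _ (hker' i).1 (hker' i).2
    have hi : ∀ i : Fin k, η i.castSucc = algebraMap ℂ R (c i) • θ i := fun i => by
      have h0 := hη.2.1 i.castSucc
      simp only [Fin.snoc_castSucc] at h0
      rw [← hc]
      exact eq_contraction_smul hW hθW hθ1 h0
    refine ⟨c, ?_, ?_⟩
    · have := sum_contraction_castSucc hη
      simp only [hc, ← map_sum] at this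
      rw [SetLike.mem_coe, LinearMap.mem_ker, coordSum_apply]
      exact hinj (by rw [this, map_zero])
    · funext i
      refine Fin.lastCases ?_ (fun i => ?_) i
      · have := hη.2.2
        rw [Fin.sum_univ_castSucc] at this
        simp only [constSnocNegSum, LinearMap.coe_mk, AddHom.coe_mk, snocNegSum, Fin.snoc_last,
          ← hi]
        exact neg_eq_of_add_eq_zero_right this
      · simp [constSnocNegSum, snocNegSum, hi]
  · rintro _ ⟨c, hc, rfl⟩
    rw [SetLike.mem_coe, LinearMap.mem_ker, coordSum_apply] at hc
    refine ⟨snocNegSum_mem dx dy hθ hθW hθ1 (by simp) (by rw [← map_sum, hc, map_zero]), ?_⟩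
    rw [SetLike.mem_coe, LinearMap.mem_ker]
    funext i
    simp only [dContractionInit_apply, dContraction_apply, constSnocNegSum, LinearMap.coe_mk,
      AddHom.coe_mk, snocNegSum, Fin.snoc_castSucc, key]
    simp

lemma constSnocNegSum_injective (hinj : Function.Injective (algebraMap ℂ R))
    (hθ1 : ∀ i, contraction P Q (θ i) = 1) : Function.Injective (constSnocNegSum θ) := by
  intro a b hab
  funext i
  apply hinj
  have h := congrArg (contraction P Q) (congrFun hab i.castSucc)
  have := hθ1 i
  simp only [constSnocNegSum, LinearMap.coe_mk, AddHom.coe_mk, snocNegSum, Fin.snoc_castSucc,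
    contraction_apply, Prod.smul_fst, Prod.smul_snd, smul_eq_mul] at h this
  linear_combination h - (algebraMap ℂ R (a i) - algebraMap ℂ R (b i)) * this

/-- The normalised forms `ω / i_X ω` are closed when `L_X ω ∧ ω = 0`. -/
lemma dy_eq_dx_of_infAut {A B u : R} (hu : u * (A * P + B * Q) = 1)
    (hL : (P * dx A + Q * dy A + A * dx P + B * dx Q) * B
      - (P * dx B + Q * dy B + A * dy P + B * dy Q) * A = 0) :
    dy (u * A) = dx (u * B) := by
  have hx := congrArg dx hu
  have hy := congrArg dy hu
  simp only [Derivation.leibniz, smul_eq_mul, map_add, Derivation.map_one_eq_zero] at hx hy ⊢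
  linear_combination (u * u) * hL + (u * A) * hy - (u * B) * hx +
    (-(u * dy A) + u * dx B - A * dy u + B * dx u) * hu

theorem finrank_abelianRel_snoc
    (hcomm : ∀ f, dy (dx f) = dx (dy f))
    (hpoinc : ∀ a b, dy a = dx b → ∃ g, dx g = a ∧ dy g = b)
    (hconst : ∀ g, dx g = 0 → dy g = 0 → ∃ c : ℂ, g = algebraMap ℂ R c)
    (hinj : Function.Injective (algebraMap ℂ R))
    (hW : ∀ i, IsUnit (contraction P Q (W i)))
    (hL : ∀ i, (P * dx (W i).1 + Q * dy (W i).1 + (W i).1 * dx P + (W i).2 * dx Q) * (W i).2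
      - (P * dx (W i).2 + Q * dy (W i).2 + (W i).1 * dy P + (W i).2 * dy Q) * (W i).1 = 0)
    (hfin : FiniteDimensional ℂ
      (abelianRel dx dy (Fin.snoc W (-Q, P) : Fin (k + 1) → R × R))) :
    Module.finrank ℂ (abelianRel dx dy (Fin.snoc W (-Q, P) : Fin (k + 1) → R × R)) =
      Module.finrank ℂ (abelianRel dx dy W) + (k - 1) := by
  choose u hu using fun i => (hW i).exists_left_inv
  simp only [contraction_apply] at hu
  let θ : Fin k → R × R := fun i => u i • W i
  have hθ : ∀ i, dy (θ i).1 = dx (θ i).2 := fun i => dy_eq_dx_of_infAut (hu i) (hL i)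
  have hθW : ∀ i, (θ i).1 * (W i).2 = (θ i).2 * (W i).1 := fun i => by
    simp only [θ, Prod.smul_fst, Prod.smul_snd, smul_eq_mul]; ring
  have hθ1 : ∀ i, contraction P Q (θ i) = 1 := fun i => by
    simp only [θ, contraction_apply, Prod.smul_fst, Prod.smul_snd, smul_eq_mul]
    linear_combination hu i
  set M := abelianRel dx dy (Fin.snoc W (-Q, P) : Fin (k + 1) → R × R)
  have h := LinearMap.finrank_range_add_finrank_ker ((dContractionInit dx dy P Q k).domRestrict M)
  rw [LinearMap.range_domRestrict,
    map_dContractionInit_abelianRel hcomm hpoinc hconst hW hθ hθW hθ1] at h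
  rw [← h]
  congr 1
  have hmap : (LinearMap.ker ((dContractionInit dx dy P Q k).domRestrict M)).map M.subtype =
      M ⊓ LinearMap.ker (dContractionInit dx dy P Q k) := by
    ext η
    simp [and_comm]
  rw [← finrank_ker_coordSum k, LinearEquiv.finrank_eq
    ((LinearMap.ker (coordSum k)).equivMapOfInjective (constSnocNegSum θ)
      (constSnocNegSum_injective hinj hθ1)),
    ← abelianRel_inf_ker_dContractionInit hconst hinj hW hθ hθW hθ1, ← hmap,
    Submodule.finrank_map_subtype_eq]

end AbelianRelations

section Analytic

variable {E F : Type*} [NormedAddCommGroup E] [NormedSpace ℂ E] [NormedAddCommGroup F]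
  [NormedSpace ℂ F]

/-- The formal primitive of a power series with values in `E →L[ℂ] F`. -/
def FormalMultilinearSeries.primitive (p : FormalMultilinearSeries ℂ E (E →L[ℂ] F)) :
    FormalMultilinearSeries ℂ E F :=
  fun n => (n : ℂ)⁻¹ • p.unshift 0 n

lemma FormalMultilinearSeries.radius_le_radius_primitive
    (p : FormalMultilinearSeries ℂ E (E →L[ℂ] F)) : p.radius ≤ p.primitive.radius := by
  rw [← FormalMultilinearSeries.radius_unshift p 0]
  refine FormalMultilinearSeries.radius_le_of_le fun n => ?_
  rw [primitive, norm_smul]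
  refine mul_le_of_le_one_left (norm_nonneg _) ?_
  rw [norm_inv, Complex.norm_natCast]
  exact Nat.cast_inv_le_one n

lemma FormalMultilinearSeries.derivSeries_primitive_apply
    (p : FormalMultilinearSeries ℂ E (E →L[ℂ] F)) (n : ℕ) (t : ℂ) (v : E) :
    p.primitive.derivSeries n (fun _ => t • v) v = p n (fun _ => t • v) v := by
  have h1 : p.primitive.derivSeries n (fun _ => t • v) =
      t ^ n • p.primitive.derivSeries n (fun _ => v) := by
    simpa using (p.primitive.derivSeries n).map_smul_univ (fun _ => t) (fun _ => v)
  have h2 : p n (fun _ => t • v) = t ^ n • p n (fun _ => v) := by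
    simpa using (p n).map_smul_univ (fun _ => t) (fun _ => v)
  have hn : ((n : ℂ) + 1) ≠ 0 := Nat.cast_add_one_ne_zero n
  have h3 : p.primitive (n + 1) (fun _ => v) = ((n : ℂ) + 1)⁻¹ • p n (fun _ => v) v := by
    rw [← Nat.cast_add_one]
    rfl
  rw [h1, h2]
  change t ^ n • p.primitive.derivSeries n (fun _ => v) v = t ^ n • p n (fun _ => v) v
  rw [FormalMultilinearSeries.derivSeries_apply_diag, h3,
    ← Nat.cast_smul_eq_nsmul ℂ, Nat.cast_add_one, smul_inv_smul₀ hn]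

/-- A function whose derivative is analytic is analytic. -/
theorem analyticAt_of_eventually_hasFDerivAt [CompleteSpace F] {f : E → F} {f' : E → E →L[ℂ] F}
    {x : E} (hf' : AnalyticAt ℂ f' x) (h : ∀ᶠ y in 𝓝 x, HasFDerivAt f (f' y) y) :
    AnalyticAt ℂ f x := by
  obtain ⟨p, r, hp⟩ := hf'
  have hqr : r ≤ p.primitive.radius := hp.r_le.trans p.radius_le_radius_primitive
  have hq : HasFPowerSeriesOnBall p.primitive.sum p.primitive 0 p.primitive.radius :=
    p.primitive.hasFPowerSeriesOnBall (hp.r_pos.trans_le hqr)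
  obtain ⟨ε, hε, hball⟩ := Metric.eventually_nhds_iff_ball.1
    (h.and (Metric.eball_mem_nhds x hp.r_pos))
  have hmem : ∀ y ∈ Metric.ball (0 : E) ε, y ∈ Metric.eball (0 : E) r ∧
      HasFDerivAt f (f' (x + y)) (x + y) := fun y hy => by
    have := hball (x + y) (by simpa using hy)
    exact ⟨by simpa [edist_eq_enorm_sub] using this.2, this.1⟩
  have key : ∀ v ∈ Metric.ball (0 : E) ε, f (x + v) = f x + p.primitive.sum v := by
    intro v hv
    have hS : IsOpen {t : ℂ | t • v ∈ Metric.ball (0 : E) ε} :=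
      Metric.isOpen_ball.preimage (by fun_prop)
    have hSc : IsPreconnected {t : ℂ | t • v ∈ Metric.ball (0 : E) ε} :=
      ((convex_ball (0 : E) ε).is_linear_preimage
        (f := fun t : ℂ => t • v)
        ⟨fun a b => add_smul a b v, fun c a => by simp [mul_smul]⟩).isPreconnected
    have hd : ∀ t ∈ {t : ℂ | t • v ∈ Metric.ball (0 : E) ε},
        HasDerivAt (fun t : ℂ => f (x + t • v) - p.primitive.sum (t • v)) 0 t := by
      intro t ht
      obtain ⟨hr, hf⟩ := hmem _ ht
      have hline : HasDerivAt (fun t : ℂ => t • v) v t := by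
        simpa using (hasDerivAt_id t).smul_const v
      have hq' : HasFDerivAt p.primitive.sum (p.primitive.derivSeries.sum (t • v)) (t • v) :=
        p.primitive.hasFDerivAt_sum (by
          simpa [edist_zero_right] using! (Metric.eball_subset_eball hqr hr))
      have h1 := (hf.comp_hasDerivAt t (hline.const_add x)).sub (hq'.comp_hasDerivAt t hline)
      have e1 := (ContinuousLinearMap.apply ℂ F v).hasSum (hp.hasSum hr)
      have e2 := (ContinuousLinearMap.apply ℂ F v).hasSum
        (hq.fderiv.hasSum (Metric.eball_subset_eball hqr hr))
      simp only [zero_add, ContinuousLinearMap.apply_apply, p.derivSeries_primitive_apply,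
        hq'.fderiv] at e1 e2
      rwa [e1.unique e2, sub_self] at h1
    have h0 : (0 : ℂ) ∈ {t : ℂ | t • v ∈ Metric.ball (0 : E) ε} := by simpa using hε
    have h1 : (1 : ℂ) ∈ {t : ℂ | t • v ∈ Metric.ball (0 : E) ε} := by simpa using hv
    have := hS.is_const_of_deriv_eq_zero hSc
      (fun t ht => (hd t ht).differentiableAt.differentiableWithinAt)
      (fun t ht => (hd t ht).deriv) h1 h0
    have hz : p.primitive.sum 0 = 0 := by
      rw [← hq.coeff_zero (fun _ => 0)]
      simp [FormalMultilinearSeries.primitive]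
    simp only [one_smul, zero_smul, add_zero, hz, sub_zero] at this
    rw [← this]; abel
  have hg : AnalyticAt ℂ (fun y => f x + p.primitive.sum (y - x)) x := by
    have h1 : AnalyticAt ℂ p.primitive.sum (x - x) := by
      rw [sub_self]; exact hq.analyticAt
    exact analyticAt_const.add (h1.fun_comp (f := fun y => y - x)
      (analyticAt_id.sub analyticAt_const))
  refine hg.congr ?_
  filter_upwards [Metric.ball_mem_nhds x hε] with y hy
  rw [← key (y - x) (by simpa [dist_eq_norm] using hy), add_sub_cancel]

/-- The Poincaré lemma for germs of holomorphic 1-forms on `ℂ²`. -/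
theorem exists_primitive_of_closed {A B : Pt → ℂ} {z : Pt} (hA : AnalyticAt ℂ A z)
    (hB : AnalyticAt ℂ B z) (hAB : ∀ᶠ p in 𝓝 z, pdy A p = pdx B p) :
    ∃ g, AnalyticAt ℂ g z ∧ ∀ᶠ p in 𝓝 z, pdx g p = A p ∧ pdy g p = B p := by
  let Ω : Pt → Pt →L[ℂ] ℂ := fun p =>
    A p • ContinuousLinearMap.fst ℂ ℂ ℂ + B p • ContinuousLinearMap.snd ℂ ℂ ℂ
  have hΩ : AnalyticAt ℂ Ω z := (hA.smul analyticAt_const).add (hB.smul analyticAt_const)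
  obtain ⟨ε, hε, hball⟩ := Metric.eventually_nhds_iff_ball.1
    (hAB.and (hA.eventually_analyticAt.and hB.eventually_analyticAt))
  have hd : ∀ a ∈ Metric.ball z ε, HasFDerivAt Ω
      ((fderiv ℂ A a).smulRight (ContinuousLinearMap.fst ℂ ℂ ℂ) +
        (fderiv ℂ B a).smulRight (ContinuousLinearMap.snd ℂ ℂ ℂ)) a := fun a ha =>
    ((hball a ha).2.1.differentiableAt.hasFDerivAt.smul_const
      (ContinuousLinearMap.fst ℂ ℂ ℂ)).add
      ((hball a ha).2.2.differentiableAt.hasFDerivAt.smul_const (ContinuousLinearMap.snd ℂ ℂ ℂ))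
  obtain ⟨g, hg⟩ := (convex_ball z ε).exists_forall_hasFDerivAt_of_fderiv_symmetric
    Metric.isOpen_ball (ω := Ω)
    (fun a ha => ((hd a ha).restrictScalars ℝ).differentiableAt.differentiableWithinAt)
    (fun a ha x y => by
      rw [((hd a ha).restrictScalars ℝ).fderiv]
      have hlin : ∀ (L : Pt →L[ℂ] ℂ) (x : Pt), L x = x.1 * L (1, 0) + x.2 * L (0, 1) := by
        intro L x
        have : x = x.1 • ((1, 0) : Pt) + x.2 • ((0, 1) : Pt) := by ext <;> simp
        conv_lhs => rw [this]
        simp only [map_add, map_smul, smul_eq_mul]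
      have hc : fderiv ℂ A a (0, 1) = fderiv ℂ B a (1, 0) := (hball a ha).1
      simp only [ContinuousLinearMap.coe_restrictScalars', add_apply,
        ContinuousLinearMap.smulRight_apply, smul_apply,
        ContinuousLinearMap.coe_fst', ContinuousLinearMap.coe_snd', smul_eq_mul]
      rw [hlin (fderiv ℂ A a) x, hlin (fderiv ℂ A a) y, hlin (fderiv ℂ B a) x,
        hlin (fderiv ℂ B a) y, hc]
      ring)
  have hev : ∀ᶠ p in 𝓝 z, HasFDerivAt g (Ω p) p := by
    filter_upwards [Metric.ball_mem_nhds z hε] with p hp using hg p hp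
  refine ⟨g, analyticAt_of_eventually_hasFDerivAt hΩ hev, ?_⟩
  filter_upwards [hev] with p hp
  simp [pdx, pdy, hp.fderiv, Ω]

/-- A function with vanishing partial derivatives near a point is constant near this point. -/
theorem eventually_eq_const_of_pdx_pdy_eq_zero {g : Pt → ℂ} {z : Pt} (hg : AnalyticAt ℂ g z)
    (hx : ∀ᶠ p in 𝓝 z, pdx g p = 0) (hy : ∀ᶠ p in 𝓝 z, pdy g p = 0) :
    ∀ᶠ p in 𝓝 z, g p = g z := by
  obtain ⟨ε, hε, hball⟩ := Metric.eventually_nhds_iff_ball.1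
    (hg.eventually_analyticAt.and (hx.and hy))
  filter_upwards [Metric.ball_mem_nhds z hε] with p hp
  refine Metric.isOpen_ball.is_const_of_fderiv_eq_zero (convex_ball z ε).isPreconnected
    (fun a ha => (hball a ha).1.differentiableAt.differentiableWithinAt) (fun a ha => ?_)
    hp (Metric.mem_ball_self hε)
  obtain ⟨-, h1, h2⟩ := hball a ha
  ext
  · simpa [pdx] using h1
  · simpa [pdy] using h2

end Analytic

section Germs

instance instAlgebraGermC : Algebra ℂ GermC :=
  Algebra.ofModule
    (fun c f g => by
      induction f using Filter.Germ.inductionOn with | _ f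
      induction g using Filter.Germ.inductionOn with | _ g
      exact congrArg (fun h : Pt → ℂ => (h : GermC)) (smul_mul_assoc c f g))
    (fun c f g => by
      induction f using Filter.Germ.inductionOn with | _ f
      induction g using Filter.Germ.inductionOn with | _ g
      exact congrArg (fun h : Pt → ℂ => (h : GermC)) (mul_smul_comm c f g))

lemma algebraMap_germC (c : ℂ) : algebraMap ℂ GermC c = ((fun _ => c : Pt → ℂ) : GermC) := by
  rw [Algebra.algebraMap_eq_smul_one]
  change (((c • (1 : Pt → ℂ) : Pt → ℂ)) : GermC) = _
  congr 1
  funext p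
  simp

/-- The algebra of germs at `0` of holomorphic functions on `ℂ²`. -/
def holGerm : Subalgebra ℂ GermC where
  carrier := {g | ∃ f : Pt → ℂ, AnalyticAt ℂ f 0 ∧ g = (f : GermC)}
  mul_mem' := by
    rintro _ _ ⟨f, hf, rfl⟩ ⟨g, hg, rfl⟩
    exact ⟨f * g, hf.mul hg, rfl⟩
  add_mem' := by
    rintro _ _ ⟨f, hf, rfl⟩ ⟨g, hg, rfl⟩
    exact ⟨f + g, hf.add hg, rfl⟩
  algebraMap_mem' c := ⟨fun _ => c, analyticAt_const, algebraMap_germC c⟩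

/-- The germ at `0` of a function holomorphic at `0`. -/
def holGerm.mk (f : Pt → ℂ) (hf : AnalyticAt ℂ f 0) : holGerm := ⟨(f : GermC), f, hf, rfl⟩

lemma holGerm.exists_rep (g : holGerm) : ∃ f hf, g = holGerm.mk f hf := by
  obtain ⟨_, f, hf, rfl⟩ := g
  exact ⟨f, hf, rfl⟩

lemma holGerm.mk_eq_mk {f g : Pt → ℂ} {hf : AnalyticAt ℂ f 0} {hg : AnalyticAt ℂ g 0} :
    holGerm.mk f hf = holGerm.mk g hg ↔ ∀ᶠ p in 𝓝 (0 : Pt), f p = g p := by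
  rw [Subtype.ext_iff]
  exact Filter.Germ.coe_eq

/-- The derivative of a germ in the direction `v`. -/
def germDirDeriv (v : Pt) : GermC → GermC :=
  Filter.Germ.map' (fun f p => fderiv ℂ f p v) fun _ _ h =>
    (h.fderiv (𝕜 := ℂ)).mono fun p hp => by simp only [hp]

lemma analyticAt_fderiv_apply {f : Pt → ℂ} {z : Pt} (hf : AnalyticAt ℂ f z) (v : Pt) :
    AnalyticAt ℂ (fun p => fderiv ℂ f p v) z :=
  (ContinuousLinearMap.apply ℂ ℂ v).analyticAt _ |>.comp hf.fderiv

/-- The directional derivative in the direction `v`, as a derivation of the algebra of germs of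
holomorphic functions. -/
def holGermDeriv (v : Pt) : Derivation ℂ holGerm holGerm :=
  Derivation.mk'
    { toFun := fun g => ⟨germDirDeriv v g, by
        obtain ⟨_, f, hf, rfl⟩ := g
        exact ⟨_, analyticAt_fderiv_apply hf v, rfl⟩⟩
      map_add' := by
        rintro ⟨_, f, hf, rfl⟩ ⟨_, g, hg, rfl⟩
        refine Subtype.ext (Filter.Germ.coe_eq.2 ?_)
        filter_upwards [hf.eventually_analyticAt, hg.eventually_analyticAt] with p hfp hgp
        change fderiv ℂ (f + g) p v = fderiv ℂ f p v + fderiv ℂ g p v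
        rw [fderiv_add hfp.differentiableAt hgp.differentiableAt]
        rfl
      map_smul' := by
        rintro c ⟨_, f, hf, rfl⟩
        refine Subtype.ext (Filter.Germ.coe_eq.2 ?_)
        filter_upwards [hf.eventually_analyticAt] with p hfp
        change fderiv ℂ (c • f) p v = c • fderiv ℂ f p v
        rw [fderiv_const_smul hfp.differentiableAt]
        rfl }
    (by
      rintro ⟨_, f, hf, rfl⟩ ⟨_, g, hg, rfl⟩
      refine Subtype.ext (Filter.Germ.coe_eq.2 ?_)
      filter_upwards [hf.eventually_analyticAt, hg.eventually_analyticAt] with p hfp hgp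
      change fderiv ℂ (f * g) p v = f p * fderiv ℂ g p v + g p * fderiv ℂ f p v
      rw [fderiv_mul hfp.differentiableAt hgp.differentiableAt]
      rfl)

lemma holGermDeriv_mk (v : Pt) {f : Pt → ℂ} (hf : AnalyticAt ℂ f 0) :
    holGermDeriv v (holGerm.mk f hf) = holGerm.mk _ (analyticAt_fderiv_apply hf v) := rfl

lemma holGermDeriv_comm (v w : Pt) (g : holGerm) :
    holGermDeriv w (holGermDeriv v g) = holGermDeriv v (holGermDeriv w g) := by
  obtain ⟨f, hf, rfl⟩ := holGerm.exists_rep g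
  simp only [holGermDeriv_mk, holGerm.mk_eq_mk]
  filter_upwards [hf.eventually_analyticAt] with p hp
  have h : ∀ u : Pt, HasFDerivAt (fun q => fderiv ℂ f q u)
      ((ContinuousLinearMap.apply ℂ ℂ u).comp (fderiv ℂ (fderiv ℂ f) p)) p := fun u =>
    (ContinuousLinearMap.apply ℂ ℂ u).hasFDerivAt.comp p hp.fderiv.differentiableAt.hasFDerivAt
  rw [(h v).fderiv, (h w).fderiv]
  have hsymm : IsSymmSndFDerivAt ℂ f p :=
    hp.contDiffAt.isSymmSndFDerivAt (n := ⊤) le_top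
  exact hsymm w v

lemma holGerm_exists_primitive (a b : holGerm)
    (hab : holGermDeriv (0, 1) a = holGermDeriv (1, 0) b) :
    ∃ g, holGermDeriv (1, 0) g = a ∧ holGermDeriv (0, 1) g = b := by
  obtain ⟨A, hA, rfl⟩ := holGerm.exists_rep a
  obtain ⟨B, hB, rfl⟩ := holGerm.exists_rep b
  obtain ⟨g, hg, hgAB⟩ := exists_primitive_of_closed hA hB
    (Filter.Germ.coe_eq.1 (congrArg Subtype.val hab))
  exact ⟨holGerm.mk g hg, Subtype.ext (Filter.Germ.coe_eq.2 (hgAB.mono fun _ h => h.1)),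
    Subtype.ext (Filter.Germ.coe_eq.2 (hgAB.mono fun _ h => h.2))⟩

lemma holGerm_eq_algebraMap_of_deriv_eq_zero (g : holGerm) (hx : holGermDeriv (1, 0) g = 0)
    (hy : holGermDeriv (0, 1) g = 0) : ∃ c : ℂ, g = algebraMap ℂ holGerm c := by
  obtain ⟨f, hf, rfl⟩ := holGerm.exists_rep g
  refine ⟨f 0, Subtype.ext ?_⟩
  have h := eventually_eq_const_of_pdx_pdy_eq_zero hf
    (Filter.Germ.coe_eq.1 (congrArg Subtype.val hx))
    (Filter.Germ.coe_eq.1 (congrArg Subtype.val hy))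
  exact (Filter.Germ.coe_eq.2 h).trans (algebraMap_germC (f 0)).symm

lemma holGerm.isUnit_mk {f : Pt → ℂ} (hf : AnalyticAt ℂ f 0) (h0 : f 0 ≠ 0) :
    IsUnit (holGerm.mk f hf) := by
  refine IsUnit.of_mul_eq_one (holGerm.mk f⁻¹ (hf.inv h0)) (Subtype.ext ?_)
  refine Filter.Germ.coe_eq.2 ?_
  filter_upwards [hf.continuousAt.eventually_ne h0] with p hp
  simp [hp]

/-- The underlying germs of a tuple of pairs of germs of holomorphic functions. -/
def holGermIncl (k : ℕ) : (Fin k → holGerm × holGerm) →ₗ[ℂ] (Fin k → GermC × GermC) :=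
  LinearMap.pi fun i => (holGerm.val.toLinearMap.prodMap holGerm.val.toLinearMap) ∘ₗ
    LinearMap.proj i

lemma holGermIncl_apply {k : ℕ} (η : Fin k → holGerm × holGerm) (i : Fin k) :
    holGermIncl k η i = ((η i).1.1, (η i).2.1) := rfl

lemma holGermIncl_injective (k : ℕ) : Function.Injective (holGermIncl k) := by
  intro a b h
  funext i
  have hi := congrFun h i
  exact Prod.ext (Subtype.ext (congrArg Prod.fst hi)) (Subtype.ext (congrArg Prod.snd hi))

lemma ARGerms_eq_map_abelianRel {k : ℕ} {U : Set Pt} (hU : U ∈ 𝓝 (0 : Pt))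
    {ω : Fin k → Form1} {W : Fin k → holGerm × holGerm}
    (hW : ∀ i, ((W i).1 : GermC) = ((ω i).1 : GermC) ∧ ((W i).2 : GermC) = ((ω i).2 : GermC)) :
    ARGerms U ω = ((abelianRel (holGermDeriv (1, 0)) (holGermDeriv (0, 1)) W).map
      (holGermIncl k) : Set (Fin k → GermC × GermC)) := by
  have htan : ∀ (η : holGerm × holGerm) (a : Form1) (i : Fin k), (η.1 : GermC) = (a.1 : GermC) →
      (η.2 : GermC) = (a.2 : GermC) → (η.1 * (W i).2 = η.2 * (W i).1 ↔
        ∀ᶠ p in 𝓝 (0 : Pt), wedge a (ω i) p = 0) := by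
    intro η a i h1 h2
    rw [Subtype.ext_iff, MulMemClass.coe_mul, MulMemClass.coe_mul, h1, h2, (hW i).1, (hW i).2,
      ← Filter.Germ.coe_mul, ← Filter.Germ.coe_mul, Filter.Germ.coe_eq]
    refine Filter.eventually_congr (Eventually.of_forall fun p => ?_)
    simp [wedge, sub_eq_zero]
  have hsum : ∀ (f : Fin k → holGerm) (a : Fin k → Pt → ℂ), (∀ i, (f i : GermC) = (a i : GermC)) →
      (∑ i, f i = 0 ↔ ∀ᶠ p in 𝓝 (0 : Pt), ∑ i, a i p = 0) := by
    intro f a h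
    have : (∑ i, (a i : GermC)) = ((∑ i, a i : Pt → ℂ) : GermC) :=
      (map_sum (Filter.Germ.coeRingHom (𝓝 (0 : Pt))) a Finset.univ).symm
    rw [Subtype.ext_iff, AddSubmonoidClass.coe_finsetSum]
    simp only [h]
    rw [this, ZeroMemClass.coe_zero, ← Filter.Germ.coe_zero, Filter.Germ.coe_eq]
    refine Filter.eventually_congr (Eventually.of_forall fun p => ?_)
    simp
  have hsum' : ∀ (η : Fin k → holGerm × holGerm) (a : Fin k → Form1),
      (∀ i, ((η i).1 : GermC) = ((a i).1 : GermC) ∧ ((η i).2 : GermC) = ((a i).2 : GermC)) →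
      (∑ i, η i = 0 ↔ ∀ᶠ p in 𝓝 (0 : Pt), ∑ i, (a i).1 p = 0 ∧ ∑ i, (a i).2 p = 0) := by
    intro η a h
    rw [Prod.ext_iff, Prod.fst_sum, Prod.snd_sum, Filter.eventually_and]
    exact and_congr (hsum _ _ fun i => (h i).1) (hsum _ _ fun i => (h i).2)
  ext η
  constructor
  · rintro ⟨V, hV, -, a, ha, hAR⟩
    have h0 := mem_of_mem_nhds hV
    refine ⟨fun i => (holGerm.mk (a i).1 ((hAR.analytic i).1 0 h0),
      holGerm.mk (a i).2 ((hAR.analytic i).2 0 h0)), ⟨fun i => ?_, fun i => ?_, ?_⟩, ?_⟩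
    · refine Subtype.ext (Filter.Germ.coe_eq.2 ?_)
      filter_upwards [hV] with p hp using hAR.closed i p hp
    · refine (htan _ (a i) i rfl rfl).2 ?_
      filter_upwards [hV] with p hp using hAR.tangent i p hp
    · refine (hsum' _ a fun i => ⟨rfl, rfl⟩).2 ?_
      filter_upwards [hV] with p hp using ⟨hAR.sum_fst p hp, hAR.sum_snd p hp⟩
    · funext i
      exact Prod.ext (ha i).1.symm (ha i).2.symm
  · rintro ⟨η, ⟨hcl, hta, hsu⟩, rfl⟩
    choose a ha hηa using fun i => holGerm.exists_rep (η i).1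
    choose b hb hηb using fun i => holGerm.exists_rep (η i).2
    have hev : ∀ᶠ p in 𝓝 (0 : Pt), p ∈ U ∧ (∀ i, AnalyticAt ℂ (a i) p ∧ AnalyticAt ℂ (b i) p ∧
        pdy (a i) p = pdx (b i) p ∧ wedge (a i, b i) (ω i) p = 0) ∧
        ∑ i, a i p = 0 ∧ ∑ i, b i p = 0 := by
      refine Filter.Eventually.and hU ((Filter.eventually_all.2 fun i => ?_).and ?_)
      · refine (ha i).eventually_analyticAt.and ((hb i).eventually_analyticAt.and (Eventually.and
          ?_ ?_))
        · have := hcl i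
          rw [hηa i, hηb i] at this
          exact Filter.Germ.coe_eq.1 (congrArg Subtype.val this)
        · refine (htan _ (a i, b i) i ?_ ?_).1 (hta i)
          · rw [hηa i]; rfl
          · rw [hηb i]; rfl
      · refine (hsum' η (fun i => (a i, b i)) fun i => ⟨?_, ?_⟩).1 hsu
        · rw [hηa i]; rfl
        · rw [hηb i]; rfl
    refine ⟨_, hev, fun p hp => hp.1, fun i => (a i, b i), fun i => ⟨?_, ?_⟩,
      fun i => ⟨fun p hp => (hp.2.1 i).1, fun p hp => (hp.2.1 i).2.1⟩,
      fun i p hp => (hp.2.1 i).2.2.1, fun i p hp => (hp.2.1 i).2.2.2,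
      fun p hp => hp.2.2.1, fun p hp => hp.2.2.2⟩
    · rw [holGermIncl_apply, hηa i]; rfl
    · rw [holGermIncl_apply, hηb i]; rfl

lemma span_ARGerms_eq_map_abelianRel {k : ℕ} {U : Set Pt} (hU : U ∈ 𝓝 (0 : Pt))
    {ω : Fin k → Form1} {W : Fin k → holGerm × holGerm}
    (hW : ∀ i, ((W i).1 : GermC) = ((ω i).1 : GermC) ∧ ((W i).2 : GermC) = ((ω i).2 : GermC)) :
    Submodule.span ℂ (ARGerms U ω) =
      (abelianRel (holGermDeriv (1, 0)) (holGermDeriv (0, 1)) W).map (holGermIncl k) := by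
  rw [ARGerms_eq_map_abelianRel hU hW, Submodule.span_eq]

end Germs

/-- **Theorem 1.** Let `W = (ω_1,…,ω_k)` be a `k`-web on a polydisc `U`
and `X = (P,Q)` a transverse infinitesimal automorphism with `X(0) ≠ (0,0)`. With
`ω_{k+1} = (−Q,P)` and `W ⊠ F_X = (ω_1,…,ω_k,ω_{k+1})`, and assuming the spaces of
abelian relations (of germs at `0`) are finite dimensional,
`dim A(W ⊠ F_X) = dim A(W) + (k − 1)`. -/
theorem stmt_12 (k : ℕ) (U : Set Pt) (hU : IsPolydisc U) (ω : Fin k → Form1)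
    (hweb : IsWeb ω U) (P Q : Pt → ℂ)
    (hP : AnalyticOnNhd ℂ P U) (hQ : AnalyticOnNhd ℂ Q U)
    (hinf : IsInfAut P Q ω U) (htr : IsTransverseTo P Q ω U)
    (hX0 : (P 0, Q 0) ≠ (0, 0))
    (hfin : FiniteDimensional ℂ ↥(Submodule.span ℂ (ARGerms U ω)))
    (hfin' : FiniteDimensional ℂ
      ↥(Submodule.span ℂ (ARGerms U (Fin.snoc ω (fun p => -Q p, P))))) :
    Module.finrank ℂ ↥(Submodule.span ℂ (ARGerms U (Fin.snoc ω (fun p => -Q p, P))))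
      = Module.finrank ℂ ↥(Submodule.span ℂ (ARGerms U ω)) + (k - 1) := by
  have hU0 : U ∈ 𝓝 (0 : Pt) := by
    obtain ⟨r, s, hr, hs, rfl⟩ := hU
    exact prod_mem_nhds (Metric.ball_mem_nhds _ hr) (Metric.ball_mem_nhds _ hs)
  have h0 : (0 : Pt) ∈ U := mem_of_mem_nhds hU0
  have hω : ∀ i, AnalyticAt ℂ (ω i).1 0 ∧ AnalyticAt ℂ (ω i).2 0 := fun i =>
    ⟨(hweb.analytic i).1 0 h0, (hweb.analytic i).2 0 h0⟩
  let W : Fin k → holGerm × holGerm := fun i =>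
    (holGerm.mk (ω i).1 (hω i).1, holGerm.mk (ω i).2 (hω i).2)
  let p : holGerm := holGerm.mk P (hP 0 h0)
  let q : holGerm := holGerm.mk Q (hQ 0 h0)
  have hspan := span_ARGerms_eq_map_abelianRel hU0 (ω := ω) (W := W) fun i => ⟨rfl, rfl⟩
  have hspan' := span_ARGerms_eq_map_abelianRel hU0
    (ω := (Fin.snoc ω (fun p => -Q p, P) : Fin (k + 1) → Form1))
    (W := (Fin.snoc W (-q, p) : Fin (k + 1) → holGerm × holGerm)) fun i => by
      refine Fin.lastCases ?_ (fun i => ?_) i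
      · simp only [Fin.snoc_last]
        exact ⟨rfl, rfl⟩
      · simp only [Fin.snoc_castSucc]
        exact ⟨rfl, rfl⟩
  have e := (abelianRel (holGermDeriv (1, 0)) (holGermDeriv (0, 1)) W).equivMapOfInjective _
    (holGermIncl_injective k)
  have e' := (abelianRel (holGermDeriv (1, 0)) (holGermDeriv (0, 1))
    (Fin.snoc W (-q, p) : Fin (k + 1) → holGerm × holGerm)).equivMapOfInjective _
    (holGermIncl_injective (k + 1))
  rw [hspan'] at hfin'
  rw [hspan, hspan', ← e.finrank_eq, ← e'.finrank_eq]
  refine finrank_abelianRel_snoc (holGermDeriv_comm _ _) holGerm_exists_primitive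
    holGerm_eq_algebraMap_of_deriv_eq_zero (algebraMap ℂ holGerm).injective (fun i => ?_)
    (fun i => ?_) (LinearEquiv.finiteDimensional e'.symm)
  · exact holGerm.isUnit_mk (((hω i).1.mul (hP 0 h0)).add ((hω i).2.mul (hQ 0 h0))) (htr i 0 h0)
  · refine Subtype.ext (Filter.Germ.coe_eq.2 ?_)
    filter_upwards [hU0] with z hz using hinf i z hz
end
end

section
/- (Second assertion of Theorem 1.) Let U ⊆ ℂ² be a polydisc centered at 0, W = (ω_1,…,ω_k) a k-web on U with k ≥ 1, and X = (P,Q) a transverse infinitesimal automorphism of W with X(0) ≠ (0,0). Set ω_{k+1} := (−Q,P) and let W ⊠ F_X be the (k+1)-web (ω_1,…,ω_k,ω_{k+1}). Assume A(W) and A(W ⊠ F_X) are finite-dimensional. Then W has maximal rank, i.e. dim_ℂ A(W) = (k−1)(k−2)/2, if and only if W ⊠ F_X has maximal rank, i.e. dim_ℂ A(W ⊠ F_X) = k(k−1)/2. -/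
open Complex Filter Topology

noncomputable section

/-- A primitive of an analytic field of linear maps is analytic. -/
theorem analyticAt_of_hasFDerivAt {E F : Type*} [NormedAddCommGroup E] [NormedSpace ℂ E]
    [NormedAddCommGroup F] [NormedSpace ℂ F] [CompleteSpace F]
    {f : E → F} {g : E → E →L[ℂ] F} {a : E}
    (hg : AnalyticAt ℂ g a) (hf : ∀ᶠ x in 𝓝 a, HasFDerivAt f (g x) x) : AnalyticAt ℂ f a := by
  obtain ⟨p, r₀, hp⟩ := hg
  obtain ⟨r, hr, hball⟩ := Metric.eventually_nhds_iff_ball.1 hf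
  set q : FormalMultilinearSeries ℂ E (E →L[ℂ] F) := fun n ↦ ((n : ℂ) + 1)⁻¹ • p n with hq
  have hqr : p.radius ≤ q.radius := FormalMultilinearSeries.radius_le_of_le fun n ↦ by
    have h1 : ‖((n : ℂ) + 1)⁻¹‖ ≤ 1 := by
      rw [norm_inv]
      apply inv_le_one_of_one_le₀
      have h2 : ‖((n + 1 : ℕ) : ℂ)‖ = (n + 1 : ℕ) := by simp only [Complex.norm_natCast]
      push_cast at h2
      rw [h2]; linarith [n.cast_nonneg (α := ℝ)]
    refine ContinuousMultilinearMap.opNorm_le_bound (norm_nonneg _) fun m ↦ ?_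
    rw [hq, smul_apply, norm_smul]
    exact (mul_le_of_le_one_left (norm_nonneg _) h1).trans ((p n).le_opNorm m)
  have hq0 : 0 < q.radius := hp.r_pos.trans_le (hp.r_le.trans hqr)
  have hG : HasFPowerSeriesOnBall (fun x ↦ q.sum (x - a)) q a q.radius := by
    simpa using (q.hasFPowerSeriesOnBall hq0).comp_sub a
  have hF : AnalyticAt ℂ (fun x ↦ f a + q.sum (x - a) (x - a)) a :=
    (hG.unshift (z := f a)).analyticAt
  refine hF.congr ?_
  filter_upwards [Metric.ball_mem_nhds a hr, Metric.eball_mem_nhds a hp.r_pos] with x hx hx'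
  obtain ⟨y, rfl⟩ : ∃ y, x = a + y := ⟨x - a, by abel⟩
  have hy : ‖y‖ < r := by simpa using hx
  have hy' : y ∈ Metric.eball (0 : E) r₀ := by simpa [edist_eq_enorm_sub] using hx'
  rcases eq_or_ne y 0 with rfl | hy0
  · simp
  -- restrict to the complex line through `a` and `a + y`
  set u : ℂ →L[ℂ] E := ContinuousLinearMap.toSpanSingleton ℂ y with hu
  have hφ : ∀ t ∈ Metric.ball (0 : ℂ) (r / ‖y‖),
      HasDerivAt (fun t : ℂ ↦ f (a + t • y)) (g (a + t • y) y) t := by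
    intro t ht
    have hmem : a + t • y ∈ Metric.ball a r := by
      rw [mem_ball_zero_iff, lt_div_iff₀ (norm_pos_iff.2 hy0)] at ht
      simpa [norm_smul] using ht
    have hline : HasDerivAt (fun t : ℂ ↦ a + t • y) y t := by
      simpa using ((hasDerivAt_id t).smul_const y).const_add a
    exact (hball _ hmem).comp_hasDerivAt t hline
  have h1r : 1 < r / ‖y‖ := by rwa [one_lt_div (norm_pos_iff.2 hy0)]
  have hψ : HasFPowerSeriesOnBall (fun t : ℂ ↦ g (a + t • y) y)
      ((ContinuousLinearMap.apply ℂ F y).compFormalMultilinearSeries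
        (p.compContinuousLinearMap u)) 0 (r₀ / ‖u‖ₑ) := by
    have h1 : HasFPowerSeriesOnBall (fun z ↦ g (a + z)) p (u 0) r₀ := by
      simpa [add_comm] using hp.comp_sub (-a)
    exact (ContinuousLinearMap.apply ℂ F y).comp_hasFPowerSeriesOnBall h1.compContinuousLinearMap
  have hderiv : deriv (fun t : ℂ ↦ f (a + t • y)) =ᶠ[𝓝 0] fun t ↦ g (a + t • y) y := by
    filter_upwards [Metric.ball_mem_nhds (0 : ℂ) (zero_lt_one.trans h1r)] with t ht
    exact (hφ t ht).deriv
  have hcoef : ∀ n : ℕ, iteratedDeriv (n + 1) (fun t : ℂ ↦ f (a + t • y)) 0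
      = n.factorial • p n (fun _ ↦ y) y := by
    intro n
    rw [iteratedDeriv_succ', hderiv.iteratedDeriv_eq, iteratedDeriv_eq_iteratedFDeriv,
      ← hψ.factorial_smul]
    change n.factorial • p n (fun _ ↦ (1 : ℂ) • y) y = _
    simp only [one_smul]
  have hT := Complex.hasSum_taylorSeries_on_ball (f := fun t : ℂ ↦ f (a + t • y)) (c := 0)
    (z := 1) (fun t ht ↦ (hφ t ht).differentiableAt.differentiableWithinAt) (by simpa using h1r)
  rw [← hasSum_nat_add_iff' 1] at hT
  have hS : HasSum (fun n ↦ q n (fun _ ↦ y) y) (q.sum y y) := by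
    have := (q.hasFPowerSeriesOnBall hq0).hasSum
      (y := y) (Metric.eball_subset_eball (hp.r_le.trans hqr) hy')
    simpa using (ContinuousLinearMap.apply ℂ F y).hasSum this
  have hST : HasSum (fun n ↦ q n (fun _ ↦ y) y) (f (a + y) - f a) := by
    convert! hT using 2 with n
    · rw [hcoef, Nat.factorial_succ, ← Nat.cast_smul_eq_nsmul ℂ, smul_smul, smul_smul]
      have := Nat.cast_ne_zero (R := ℂ).2 n.factorial_ne_zero
      simp only [hq, smul_apply, sub_zero, one_pow]
      congr 1
      push_cast
      field_simp
    · simp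
    · simp
  simp [← hST.unique hS]

section PartialDerivatives

variable {f g : Pt → ℂ} {p : Pt}

theorem pdx_add (hf : DifferentiableAt ℂ f p) (hg : DifferentiableAt ℂ g p) :
    pdx (f + g) p = pdx f p + pdx g p := by
  simp [pdx, fderiv_add hf hg]

theorem pdy_add (hf : DifferentiableAt ℂ f p) (hg : DifferentiableAt ℂ g p) :
    pdy (f + g) p = pdy f p + pdy g p := by
  simp [pdy, fderiv_add hf hg]

theorem pdx_smul (c : ℂ) (hf : DifferentiableAt ℂ f p) : pdx (c • f) p = c * pdx f p := by
  simp [pdx, fderiv_const_smul hf]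

theorem pdy_smul (c : ℂ) (hf : DifferentiableAt ℂ f p) : pdy (c • f) p = c * pdy f p := by
  simp [pdy, fderiv_const_smul hf]

theorem pdx_neg : pdx (fun q ↦ -f q) p = -pdx f p := by
  simp [pdx, fderiv_fun_neg]

theorem pdy_neg : pdy (fun q ↦ -f q) p = -pdy f p := by
  simp [pdy, fderiv_fun_neg]

theorem pdx_sum {ι : Type*} (s : Finset ι) {F : ι → Pt → ℂ}
    (hF : ∀ i ∈ s, DifferentiableAt ℂ (F i) p) :
    pdx (fun q ↦ ∑ i ∈ s, F i q) p = ∑ i ∈ s, pdx (F i) p := by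
  simp [pdx, fderiv_fun_sum hF]

theorem pdy_sum {ι : Type*} (s : Finset ι) {F : ι → Pt → ℂ}
    (hF : ∀ i ∈ s, DifferentiableAt ℂ (F i) p) :
    pdy (fun q ↦ ∑ i ∈ s, F i q) p = ∑ i ∈ s, pdy (F i) p := by
  simp [pdy, fderiv_fun_sum hF]

theorem pdx_mul (hf : DifferentiableAt ℂ f p) (hg : DifferentiableAt ℂ g p) :
    pdx (fun q ↦ f q * g q) p = pdx f p * g p + f p * pdx g p := by
  simp [pdx, fderiv_fun_mul hf hg]; ring

theorem pdy_mul (hf : DifferentiableAt ℂ f p) (hg : DifferentiableAt ℂ g p) :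
    pdy (fun q ↦ f q * g q) p = pdy f p * g p + f p * pdy g p := by
  simp [pdy, fderiv_fun_mul hf hg]; ring

theorem fderiv_apply_eq (v : Pt) : fderiv ℂ f p v = pdx f p * v.1 + pdy f p * v.2 := by
  have hv : v = v.1 • (1, 0) + v.2 • (0, 1) := by ext <;> simp
  conv_lhs => rw [hv]
  rw [map_add, map_smul, map_smul, pdx, pdy, smul_eq_mul, smul_eq_mul]
  ring

theorem Filter.EventuallyEq.pdx_eq (h : f =ᶠ[𝓝 p] g) : pdx f p = pdx g p := by
  rw [pdx, pdx, h.fderiv_eq]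

theorem Filter.EventuallyEq.pdy_eq (h : f =ᶠ[𝓝 p] g) : pdy f p = pdy g p := by
  rw [pdy, pdy, h.fderiv_eq]

theorem AnalyticAt.pdx (hf : AnalyticAt ℂ f p) : AnalyticAt ℂ (pdx f) p :=
  (ContinuousLinearMap.apply ℂ ℂ ((1, 0) : Pt)).analyticAt _ |>.comp hf.fderiv

theorem AnalyticAt.pdy (hf : AnalyticAt ℂ f p) : AnalyticAt ℂ (pdy f) p :=
  (ContinuousLinearMap.apply ℂ ℂ ((0, 1) : Pt)).analyticAt _ |>.comp hf.fderiv

theorem pdy_pdx_eq_pdx_pdy (hf : AnalyticAt ℂ f p) : pdy (pdx f) p = pdx (pdy f) p := by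
  have hd : DifferentiableAt ℂ (fderiv ℂ f) p := hf.fderiv.differentiableAt
  have hsymm : IsSymmSndFDerivAt ℂ f p :=
    (hf.contDiffAt (n := ⊤)).isSymmSndFDerivAt (by simp)
  have h (v w : Pt) : fderiv ℂ (fun q ↦ fderiv ℂ f q v) p w = fderiv ℂ (fderiv ℂ f) p w v := by
    rw [fderiv_clm_apply hd (differentiableAt_const v)]
    simp
  change fderiv ℂ (fun q ↦ fderiv ℂ f q (1, 0)) p (0, 1)
    = fderiv ℂ (fun q ↦ fderiv ℂ f q (0, 1)) p (1, 0)
  rw [h, h, hsymm]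

/-- A function with vanishing partial derivatives is locally constant. -/
theorem eventually_eq_const_of_pd_eq_zero
    (h : ∀ᶠ q in 𝓝 p, AnalyticAt ℂ f q ∧ pdx f q = 0 ∧ pdy f q = 0) :
    ∀ᶠ q in 𝓝 p, f q = f p := by
  obtain ⟨r, hr, hball⟩ := Metric.eventually_nhds_iff_ball.1 h
  filter_upwards [Metric.ball_mem_nhds p hr] with q hq
  refine Metric.isOpen_ball.is_const_of_fderiv_eq_zero (𝕜 := ℂ)
    (convex_ball p r).isPreconnected
    (fun q hq ↦ (hball q hq).1.differentiableAt.differentiableWithinAt) (fun q hq ↦ ?_)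
    hq (Metric.mem_ball_self hr)
  ext <;> simp [fderiv_apply_eq, hball q hq]

/-- The holomorphic Poincaré lemma. -/
theorem exists_primitive {a : Form1}
    (ha : ∀ᶠ q in 𝓝 p, AnalyticAt ℂ a.1 q ∧ AnalyticAt ℂ a.2 q ∧ pdy a.1 q = pdx a.2 q) :
    ∃ f : Pt → ℂ, f p = 0 ∧
      ∀ᶠ q in 𝓝 p, AnalyticAt ℂ f q ∧ pdx f q = a.1 q ∧ pdy f q = a.2 q := by
  obtain ⟨r, hr, hball⟩ := Metric.eventually_nhds_iff_ball.1 ha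
  set L : Pt → Pt →L[ℂ] ℂ := fun q ↦
    a.1 q • ContinuousLinearMap.fst ℂ ℂ ℂ + a.2 q • ContinuousLinearMap.snd ℂ ℂ ℂ with hL
  have hLan : ∀ q ∈ Metric.ball p r, AnalyticAt ℂ L q := fun q hq ↦
    ((hball q hq).1.smul analyticAt_const).add ((hball q hq).2.1.smul analyticAt_const)
  have hLd : ∀ q ∈ Metric.ball p r, ∀ v w : Pt,
      fderiv ℂ L q v w = fderiv ℂ a.1 q v * w.1 + fderiv ℂ a.2 q v * w.2 := by
    intro q hq v w
    have h : HasFDerivAt L _ q :=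
      ((hball q hq).1.differentiableAt.hasFDerivAt.smul_const (ContinuousLinearMap.fst ℂ ℂ ℂ)).add
        ((hball q hq).2.1.differentiableAt.hasFDerivAt.smul_const (ContinuousLinearMap.snd ℂ ℂ ℂ))
    simp [h.fderiv]
  obtain ⟨F, hF⟩ := (convex_ball p r).exists_forall_hasFDerivWithinAt_of_hasFDerivWithinAt_symmetric
    (ω := L) (dω := fun q ↦ (fderiv ℂ L q).restrictScalars ℝ)
    (fun q hq ↦ ((hLan q hq).differentiableAt.hasFDerivAt.restrictScalars ℝ).hasFDerivWithinAt)
    (fun q hq v _ w _ ↦ by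
      have hc := (hball q hq).2.2
      simp only [ContinuousLinearMap.coe_restrictScalars', hLd q hq, fderiv_apply_eq, hc]
      ring)
  have hF' : ∀ q ∈ Metric.ball p r, HasFDerivAt F (L q) q := fun q hq ↦
    (hF q hq).hasFDerivAt (Metric.isOpen_ball.mem_nhds hq)
  have hF'' : ∀ q ∈ Metric.ball p r, HasFDerivAt (fun q ↦ F q - F p) (L q) q := fun q hq ↦
    (hF' q hq).sub_const _
  refine ⟨fun q ↦ F q - F p, sub_self _, ?_⟩
  filter_upwards [Metric.ball_mem_nhds p hr] with q hq
  refine ⟨analyticAt_of_hasFDerivAt (hLan q hq) ?_, ?_, ?_⟩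
  · filter_upwards [Metric.isOpen_ball.mem_nhds hq] with x hx using hF'' x hx
  · simp [_root_.pdx, (hF'' q hq).fderiv, hL]
  · simp [_root_.pdy, (hF'' q hq).fderiv, hL]

end PartialDerivatives

section NormalizedForms

/-- The hypotheses at a point `p` on a 1-form `ω` and a transverse infinitesimal automorphism
`(P, Q)` of the foliation it defines. -/
structure IsTransverseInfAutAt (P Q : Pt → ℂ) (ω : Form1) (p : Pt) : Prop where
  analytic_P : AnalyticAt ℂ P p
  analytic_Q : AnalyticAt ℂ Q p
  analytic_fst : AnalyticAt ℂ ω.1 p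
  analytic_snd : AnalyticAt ℂ ω.2 p
  contr_ne_zero : contr P Q ω p ≠ 0
  wedge_lie : wedge (lie P Q ω) ω p = 0

/-- The form `ω / (i_X ω)`, where `X = (P, Q)`. -/
def normalizedForm (P Q : Pt → ℂ) (ω : Form1) : Form1 :=
  (fun p ↦ ω.1 p / contr P Q ω p, fun p ↦ ω.2 p / contr P Q ω p)

namespace IsTransverseInfAutAt

variable {P Q f : Pt → ℂ} {ω : Form1} {p : Pt}

theorem analytic_contr (h : IsTransverseInfAutAt P Q ω p) : AnalyticAt ℂ (contr P Q ω) p :=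
  (h.analytic_fst.mul h.analytic_P).add (h.analytic_snd.mul h.analytic_Q)

theorem analytic_normalizedForm (h : IsTransverseInfAutAt P Q ω p) :
    AnalyticAt ℂ (normalizedForm P Q ω).1 p ∧ AnalyticAt ℂ (normalizedForm P Q ω).2 p :=
  ⟨h.analytic_fst.div h.analytic_contr h.contr_ne_zero,
    h.analytic_snd.div h.analytic_contr h.contr_ne_zero⟩

theorem contr_normalizedForm (h : IsTransverseInfAutAt P Q ω p) :
    contr P Q (normalizedForm P Q ω) p = 1 := by
  have h0 := h.contr_ne_zero
  simp only [contr, normalizedForm] at h0 ⊢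
  field_simp

/-- `ω / (i_X ω)` is closed. -/
theorem normalizedForm_closed (h : IsTransverseInfAutAt P Q ω p) :
    pdy (normalizedForm P Q ω).1 p = pdx (normalizedForm P Q ω).2 p := by
  have hc := h.analytic_contr
  obtain ⟨h1, h2⟩ := h.analytic_normalizedForm
  have hne := hc.continuousAt.eventually_ne h.contr_ne_zero
  have e1 : ω.1 =ᶠ[𝓝 p] fun q ↦ (normalizedForm P Q ω).1 q * contr P Q ω q := by
    filter_upwards [hne] with q hq
    simp only [normalizedForm]; field_simp
  have e2 : ω.2 =ᶠ[𝓝 p] fun q ↦ (normalizedForm P Q ω).2 q * contr P Q ω q := by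
    filter_upwards [hne] with q hq
    simp only [normalizedForm]; field_simp
  have d1 := e1.pdy_eq
  have d2 := e2.pdx_eq
  rw [pdy_mul h1.differentiableAt hc.differentiableAt] at d1
  rw [pdx_mul h2.differentiableAt hc.differentiableAt] at d2
  have v1 := e1.eq_of_nhds
  have v2 := e2.eq_of_nhds
  have hA := h.analytic_fst.differentiableAt
  have hB := h.analytic_snd.differentiableAt
  have hP := h.analytic_P.differentiableAt
  have hQ := h.analytic_Q.differentiableAt
  have cx : pdx (contr P Q ω) p = pdx ω.1 p * P p + ω.1 p * pdx P p
      + (pdx ω.2 p * Q p + ω.2 p * pdx Q p) := by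
    rw [← pdx_mul hA hP, ← pdx_mul hB hQ]
    exact pdx_add (hA.mul hP) (hB.mul hQ)
  have cy : pdy (contr P Q ω) p = pdy ω.1 p * P p + ω.1 p * pdy P p
      + (pdy ω.2 p * Q p + ω.2 p * pdy Q p) := by
    rw [← pdy_mul hA hP, ← pdy_mul hB hQ]
    exact pdy_add (hA.mul hP) (hB.mul hQ)
  have hw := h.wedge_lie
  have h0 := h.contr_ne_zero
  have hcv : contr P Q ω p = ω.1 p * P p + ω.2 p * Q p := rfl
  simp only [wedge, lie, Xf] at hw
  have key : contr P Q ω p * contr P Q ω p *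
      (pdy (normalizedForm P Q ω).1 p - pdx (normalizedForm P Q ω).2 p) = 0 := by
    generalize contr P Q ω p = c at *
    generalize pdy (normalizedForm P Q ω).1 p = a1y at *
    generalize pdx (normalizedForm P Q ω).2 p = a2x at *
    generalize (normalizedForm P Q ω).1 p = a1 at *
    generalize (normalizedForm P Q ω).2 p = a2 at *
    have h3 : (pdy ω.1 p - pdx ω.2 p) * c =
        ω.1 p * pdy (contr P Q ω) p - ω.2 p * pdx (contr P Q ω) p := by
      rw [cx, cy]
      linear_combination hw + (pdy ω.1 p - pdx ω.2 p) * hcv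
    linear_combination h3 - c * d1 + c * d2 +
      pdy (contr P Q ω) p * v1 - pdx (contr P Q ω) p * v2
  have := (mul_eq_zero.1 key).resolve_left (mul_ne_zero h0 h0)
  exact sub_eq_zero.1 this

/-- A multiple `f ω / (i_X ω)` is closed exactly when `df ∧ ω = 0`. -/
theorem mul_normalizedForm_closed_iff (h : IsTransverseInfAutAt P Q ω p)
    (hf : AnalyticAt ℂ f p) :
    pdy (fun q ↦ f q * (normalizedForm P Q ω).1 q) p
      = pdx (fun q ↦ f q * (normalizedForm P Q ω).2 q) p ↔ wedge (fd f) ω p = 0 := by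
  obtain ⟨h1, h2⟩ := h.analytic_normalizedForm
  rw [pdy_mul hf.differentiableAt h1.differentiableAt,
    pdx_mul hf.differentiableAt h2.differentiableAt, h.normalizedForm_closed]
  have h0 := h.contr_ne_zero
  simp only [normalizedForm, wedge, fd]
  constructor
  · intro e
    field_simp at e
    linear_combination -e
  · intro e
    field_simp
    linear_combination -e

/-- A form proportional to `ω` is recovered from its contraction with `X`. -/
theorem contr_mul_normalizedForm (h : IsTransverseInfAutAt P Q ω p) {a : Form1}
    (ha : wedge a ω p = 0) :
    contr P Q a p * (normalizedForm P Q ω).1 p = a.1 p ∧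
      contr P Q a p * (normalizedForm P Q ω).2 p = a.2 p := by
  have h0 := h.contr_ne_zero
  simp only [wedge] at ha
  simp only [normalizedForm, contr] at *
  constructor
  · rw [mul_div_assoc', div_eq_iff h0]
    linear_combination -Q p * ha
  · rw [mul_div_assoc', div_eq_iff h0]
    linear_combination P p * ha

end IsTransverseInfAutAt

end NormalizedForms

section NullSums

variable {k : ℕ} {ω : Fin k → Form1} {P Q : Pt → ℂ}

/-- Membership in `ARGerms` only depends on the behaviour near the origin. -/
theorem mem_ARGerms_iff {U : Set Pt} (hU : U ∈ 𝓝 (0 : Pt)) {η : Fin k → GermC × GermC} :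
    η ∈ ARGerms U ω ↔ ∃ a : Fin k → Form1,
      (∀ i, η i = (((a i).1 : GermC), ((a i).2 : GermC))) ∧
        ∀ᶠ p in 𝓝 (0 : Pt), IsAbelianRelOn ω a {p} := by
  constructor
  · rintro ⟨V, hV, -, a, hη, ha⟩
    refine ⟨a, fun i ↦ Prod.ext (hη i).1 (hη i).2, ?_⟩
    filter_upwards [hV] with p hp
    have hs : {p} ⊆ V := Set.singleton_subset_iff.2 hp
    exact ⟨fun i ↦ ⟨(ha.analytic i).1.mono hs, (ha.analytic i).2.mono hs⟩,
      fun i q hq ↦ ha.closed i q (hs hq), fun i q hq ↦ ha.tangent i q (hs hq),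
      fun q hq ↦ ha.sum_fst q (hs hq), fun q hq ↦ ha.sum_snd q (hs hq)⟩
  · rintro ⟨a, hη, ha⟩
    refine ⟨{p | p ∈ U ∧ IsAbelianRelOn ω a {p}}, Filter.inter_mem hU ha, fun p hp ↦ hp.1, a,
      fun i ↦ by simp [hη i], ?_⟩
    exact ⟨fun i ↦ ⟨fun p hp ↦ (hp.2.analytic i).1 p rfl, fun p hp ↦ (hp.2.analytic i).2 p rfl⟩,
      fun i p hp ↦ hp.2.closed i p rfl, fun i p hp ↦ hp.2.tangent i p rfl,
      fun p hp ↦ hp.2.sum_fst p rfl, fun p hp ↦ hp.2.sum_snd p rfl⟩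

/-- A tuple of first integrals `f i` of the foliations `ω i` near the origin, with sum zero. -/
def IsNullSum (ω : Fin k → Form1) (f : Fin k → Pt → ℂ) : Prop :=
  ∀ᶠ p in 𝓝 (0 : Pt), (∀ i, AnalyticAt ℂ (f i) p ∧ wedge (fd (f i)) (ω i) p = 0) ∧
    ∑ i, f i p = 0

theorem IsNullSum.add {f g : Fin k → Pt → ℂ} (hf : IsNullSum ω f) (hg : IsNullSum ω g) :
    IsNullSum ω (fun i ↦ f i + g i) := by
  filter_upwards [hf, hg] with p hf hg
  refine ⟨fun i ↦ ⟨(hf.1 i).1.add (hg.1 i).1, ?_⟩, ?_⟩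
  · have h1 := (hf.1 i).2
    have h2 := (hg.1 i).2
    simp only [wedge, fd] at h1 h2 ⊢
    rw [pdx_add (hf.1 i).1.differentiableAt (hg.1 i).1.differentiableAt,
      pdy_add (hf.1 i).1.differentiableAt (hg.1 i).1.differentiableAt]
    linear_combination h1 + h2
  · simp [Finset.sum_add_distrib, hf.2, hg.2]

theorem IsNullSum.smul {f : Fin k → Pt → ℂ} (c : ℂ) (hf : IsNullSum ω f) :
    IsNullSum ω (fun i ↦ c • f i) := by
  filter_upwards [hf] with p hf
  refine ⟨fun i ↦ ⟨analyticAt_const.smul (hf.1 i).1, ?_⟩, ?_⟩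
  · have h1 := (hf.1 i).2
    simp only [wedge, fd] at h1 ⊢
    rw [pdx_smul c (hf.1 i).1.differentiableAt, pdy_smul c (hf.1 i).1.differentiableAt]
    linear_combination c * h1
  · simp [← Finset.mul_sum, hf.2]

theorem isNullSum_const {c : Fin k → ℂ} (hc : ∑ i, c i = 0) :
    IsNullSum ω (fun i _ ↦ c i) :=
  .of_forall fun p ↦ ⟨fun i ↦ ⟨analyticAt_const, by simp [wedge, fd, pdx, pdy]⟩, hc⟩

/-- Germs at the origin of tuples of first integrals with sum zero. -/
def nullSums (ω : Fin k → Form1) : Submodule ℂ (Fin k → GermC) where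
  carrier := {h | ∃ f, IsNullSum ω f ∧ h = fun i ↦ (f i : GermC)}
  add_mem' := by
    rintro _ _ ⟨f, hf, rfl⟩ ⟨g, hg, rfl⟩
    exact ⟨_, hf.add hg, rfl⟩
  zero_mem' := ⟨fun _ _ ↦ 0, isNullSum_const (by simp), rfl⟩
  smul_mem' := by
    rintro c _ ⟨f, hf, rfl⟩
    exact ⟨_, hf.smul c, rfl⟩

/-- The differential of a germ. -/
def germDiff (g : GermC) : GermC × GermC :=
  (Filter.Germ.map' pdx (fun _ _ h ↦ h.eventually_nhds.mono fun _ ↦ Filter.EventuallyEq.pdx_eq) g,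
    Filter.Germ.map' pdy (fun _ _ h ↦ h.eventually_nhds.mono fun _ ↦ Filter.EventuallyEq.pdy_eq) g)

/-- The differential of a null sum of first integrals. -/
def nullSumsDiff (ω : Fin k → Form1) : nullSums ω →ₗ[ℂ] (Fin k → GermC × GermC) where
  toFun h i := germDiff (h.1 i)
  map_add' := by
    rintro ⟨_, f, hf, rfl⟩ ⟨_, g, hg, rfl⟩
    funext i
    refine Prod.ext (Filter.Germ.coe_eq.2 ?_) (Filter.Germ.coe_eq.2 ?_)
    · filter_upwards [hf, hg] with p hf hg
      exact pdx_add (hf.1 i).1.differentiableAt (hg.1 i).1.differentiableAt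
    · filter_upwards [hf, hg] with p hf hg
      exact pdy_add (hf.1 i).1.differentiableAt (hg.1 i).1.differentiableAt
  map_smul' := by
    rintro c ⟨_, f, hf, rfl⟩
    funext i
    refine Prod.ext (Filter.Germ.coe_eq.2 ?_) (Filter.Germ.coe_eq.2 ?_)
    · filter_upwards [hf] with p hf
      exact pdx_smul c (hf.1 i).1.differentiableAt
    · filter_upwards [hf] with p hf
      exact pdy_smul c (hf.1 i).1.differentiableAt

theorem range_nullSumsDiff {U : Set Pt} (hU : U ∈ 𝓝 (0 : Pt)) :
    ((nullSumsDiff ω).range : Set (Fin k → GermC × GermC)) = ARGerms U ω := by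
  ext η
  rw [mem_ARGerms_iff hU]
  constructor
  · rintro ⟨⟨_, f, hf, rfl⟩, rfl⟩
    refine ⟨fun i ↦ fd (f i), fun i ↦ rfl, ?_⟩
    filter_upwards [hf, hf.eventually_nhds] with p hf hf'
    have hsum : (fun q ↦ ∑ i, f i q) =ᶠ[𝓝 p] fun _ ↦ 0 := hf'.mono fun q hq ↦ hq.2
    have hd : ∀ i ∈ Finset.univ, DifferentiableAt ℂ (f i) p := fun i _ ↦ (hf.1 i).1.differentiableAt
    refine ⟨?_, ?_, ?_, ?_, ?_⟩
    · refine fun i ↦ ⟨?_, ?_⟩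
      · rintro _ rfl; exact (hf.1 i).1.pdx
      · rintro _ rfl; exact (hf.1 i).1.pdy
    · rintro i _ rfl; exact pdy_pdx_eq_pdx_pdy (hf.1 i).1
    · rintro i _ rfl; exact (hf.1 i).2
    · rintro _ rfl
      simp only [fd]
      rw [← pdx_sum _ hd, hsum.pdx_eq]
      simp [pdx]
    · rintro _ rfl
      simp only [fd]
      rw [← pdy_sum _ hd, hsum.pdy_eq]
      simp [pdy]
  · rintro ⟨a, hη, ha⟩
    choose f hf0 hf using fun i ↦ exists_primitive (p := 0) (a := a i) <|
      ha.mono fun q hq ↦ ⟨(hq.analytic i).1 q rfl, (hq.analytic i).2 q rfl, hq.closed i q rfl⟩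
    have hf' := eventually_all.2 hf
    have hsum : ∀ᶠ q in 𝓝 (0 : Pt), ∑ i, f i q = ∑ i, f i 0 := by
      refine eventually_eq_const_of_pd_eq_zero (f := fun q ↦ ∑ i, f i q) ?_
      filter_upwards [hf', ha] with q hq hq'
      have hd : ∀ i ∈ Finset.univ, DifferentiableAt ℂ (f i) q :=
        fun i _ ↦ (hq i).1.differentiableAt
      refine ⟨Finset.analyticAt_fun_sum _ fun i _ ↦ (hq i).1, ?_, ?_⟩
      · rw [pdx_sum _ hd, ← hq'.sum_fst q rfl]
        exact Finset.sum_congr rfl fun i _ ↦ (hq i).2.1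
      · rw [pdy_sum _ hd, ← hq'.sum_snd q rfl]
        exact Finset.sum_congr rfl fun i _ ↦ (hq i).2.2
    have hnull : IsNullSum ω f := by
      filter_upwards [hf', ha, hsum] with q hq hq' hs
      refine ⟨fun i ↦ ⟨(hq i).1, ?_⟩, by simp [hs, hf0]⟩
      rw [← hq'.tangent i q rfl]
      simp [wedge, fd, (hq i).2]
    refine ⟨⟨_, f, hnull, rfl⟩, ?_⟩
    funext i
    rw [hη i]
    exact Prod.ext (Filter.Germ.coe_eq.2 ((hf i).mono fun q hq ↦ hq.2.1))
      (Filter.Germ.coe_eq.2 ((hf i).mono fun q hq ↦ hq.2.2))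

/-- The linear map sending a tuple of constants to the corresponding tuple of germs. -/
def constGerms (k : ℕ) : (Fin k → ℂ) →ₗ[ℂ] (Fin k → GermC) where
  toFun c i := ((fun _ ↦ c i : Pt → ℂ) : GermC)
  map_add' _ _ := rfl
  map_smul' _ _ := rfl

theorem constGerms_injective (k : ℕ) : Function.Injective (constGerms k) := by
  intro c d h
  funext i
  exact (Filter.Germ.coe_eq.1 (congrFun h i)).eq_of_nhds

/-- The kernel of the differential consists of the constants with sum zero. -/
theorem map_ker_nullSumsDiff :
    (nullSumsDiff ω).ker.map (nullSums ω).subtype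
      = (∑ i, LinearMap.proj (R := ℂ) (φ := fun _ : Fin k ↦ ℂ) i).ker.map (constGerms k) := by
  ext h
  simp only [Submodule.mem_map, LinearMap.mem_ker, Submodule.subtype_apply]
  constructor
  · rintro ⟨⟨_, f, hf, rfl⟩, hker, rfl⟩
    refine ⟨fun i ↦ f i 0, by simpa using hf.self_of_nhds.2, ?_⟩
    funext i
    refine (Filter.Germ.coe_eq.2 ?_).symm
    have hi := congrFun hker i
    refine eventually_eq_const_of_pd_eq_zero ?_
    filter_upwards [hf, Filter.Germ.coe_eq.1 (congrArg Prod.fst hi),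
      Filter.Germ.coe_eq.1 (congrArg Prod.snd hi)] with q hq h1 h2
    exact ⟨(hq.1 i).1, h1, h2⟩
  · rintro ⟨c, hc, rfl⟩
    refine ⟨⟨_, fun i _ ↦ c i, isNullSum_const (by simpa using hc), rfl⟩, ?_, rfl⟩
    funext i
    refine Prod.ext (Filter.Germ.coe_eq.2 (.of_forall fun q ↦ ?_))
      (Filter.Germ.coe_eq.2 (.of_forall fun q ↦ ?_))
    · simp [pdx]
    · simp [pdy]

theorem finrank_ker_nullSumsDiff (hk : 1 ≤ k) :
    Module.finrank ℂ (nullSumsDiff ω).ker = k - 1 := by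
  set σ : (Fin k → ℂ) →ₗ[ℂ] ℂ := ∑ i, LinearMap.proj (R := ℂ) (φ := fun _ : Fin k ↦ ℂ) i with hσ
  have hsurj : Function.Surjective σ := fun z ↦ ⟨Pi.single ⟨0, hk⟩ z, by simp [hσ]⟩
  have hrank := σ.finrank_range_add_finrank_ker
  rw [LinearMap.range_eq_top.2 hsurj, finrank_top, Module.finrank_self,
    Module.finrank_fin_fun] at hrank
  rw [← Submodule.finrank_map_subtype_eq, map_ker_nullSumsDiff,
    ← (Submodule.equivMapOfInjective _ (constGerms_injective k) _).finrank_eq]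
  change Module.finrank ℂ σ.ker = k - 1
  omega

end NullSums

section ExtendedWeb

variable {k : ℕ} {ω : Fin k → Form1} {P Q : Pt → ℂ}

/-- The tuple `(f_i ω_i / (i_X ω_i))_i`, completed by minus its sum. -/
def extendedRel (P Q : Pt → ℂ) (ω : Fin k → Form1) (f : Fin k → Pt → ℂ) :
    Fin (k + 1) → Form1 :=
  Fin.snoc (fun i ↦ (fun p ↦ f i p * (normalizedForm P Q (ω i)).1 p,
      fun p ↦ f i p * (normalizedForm P Q (ω i)).2 p))
    (fun p ↦ -∑ i, f i p * (normalizedForm P Q (ω i)).1 p,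
      fun p ↦ -∑ i, f i p * (normalizedForm P Q (ω i)).2 p)

theorem isAbelianRelOn_extendedRel {f : Fin k → Pt → ℂ} {p : Pt}
    (hω : ∀ i, IsTransverseInfAutAt P Q (ω i) p)
    (hf : ∀ i, AnalyticAt ℂ (f i) p ∧ wedge (fd (f i)) (ω i) p = 0) (hsum : ∑ i, f i p = 0) :
    IsAbelianRelOn (Fin.snoc ω (fun p ↦ -Q p, P)) (extendedRel P Q ω f) {p} := by
  have h1 (i) : AnalyticAt ℂ (fun q ↦ f i q * (normalizedForm P Q (ω i)).1 q) p :=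
    (hf i).1.mul (hω i).analytic_normalizedForm.1
  have h2 (i) : AnalyticAt ℂ (fun q ↦ f i q * (normalizedForm P Q (ω i)).2 q) p :=
    (hf i).1.mul (hω i).analytic_normalizedForm.2
  have hclosed (i) := ((hω i).mul_normalizedForm_closed_iff (hf i).1).2 (hf i).2
  refine ⟨fun i ↦ ⟨?_, ?_⟩, fun i ↦ ?_, fun i ↦ ?_, ?_, ?_⟩ <;> rintro _ rfl
  · refine Fin.lastCases ?_ (fun i ↦ ?_) i
    · simp only [extendedRel, Fin.snoc_last]
      exact (Finset.analyticAt_fun_sum Finset.univ fun i _ ↦ h1 i).neg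
    · simpa [extendedRel] using h1 i
  · refine Fin.lastCases ?_ (fun i ↦ ?_) i
    · simp only [extendedRel, Fin.snoc_last]
      exact (Finset.analyticAt_fun_sum Finset.univ fun i _ ↦ h2 i).neg
    · simpa [extendedRel] using h2 i
  · refine Fin.lastCases ?_ (fun i ↦ ?_) i
    · simp only [extendedRel, Fin.snoc_last]
      rw [pdx_neg, pdy_neg, pdx_sum _ fun i _ ↦ (h2 i).differentiableAt,
        pdy_sum _ fun i _ ↦ (h1 i).differentiableAt, Finset.sum_congr rfl fun i _ ↦ hclosed i]
    · simpa only [extendedRel, Fin.snoc_castSucc] using hclosed i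
  · refine Fin.lastCases ?_ (fun i ↦ ?_) i
    · simp only [extendedRel, Fin.snoc_last, wedge]
      rw [← neg_eq_zero, ← hsum, neg_mul, neg_mul_neg, Finset.sum_mul, Finset.sum_mul, neg_sub,
        sub_neg_eq_add, ← Finset.sum_add_distrib]
      refine Finset.sum_congr rfl fun i _ ↦ ?_
      have := (hω i).contr_normalizedForm
      simp only [contr] at this
      linear_combination f i _ * this
    · simp only [extendedRel, Fin.snoc_castSucc, wedge, normalizedForm]
      ring
  · simp [Fin.sum_univ_castSucc, extendedRel]
  · simp [Fin.sum_univ_castSucc, extendedRel]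

/-- The map on germs induced by `extendedRel`. -/
def extendedRelMap (P Q : Pt → ℂ) (ω : Fin k → Form1) :
    (Fin k → GermC) →ₗ[ℂ] (Fin (k + 1) → GermC × GermC) where
  toFun h := Fin.snoc (α := fun _ ↦ GermC × GermC)
    (fun i ↦ (h i * ((normalizedForm P Q (ω i)).1 : GermC),
      h i * ((normalizedForm P Q (ω i)).2 : GermC)))
    (-∑ i, h i * ((normalizedForm P Q (ω i)).1 : GermC),
      -∑ i, h i * ((normalizedForm P Q (ω i)).2 : GermC))
  map_add' g h := by
    funext i
    refine Fin.lastCases ?_ (fun i ↦ ?_) i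
    · simp [add_mul, Finset.sum_add_distrib, add_comm]
    · simp [add_mul]
  map_smul' c h := by
    have hmul (x y : GermC) : (c • x) * y = c • (x * y) := by
      induction x using Filter.Germ.inductionOn with | _ x
      induction y using Filter.Germ.inductionOn with | _ y
      exact congrArg _ (smul_mul_assoc c x y)
    funext i
    refine Fin.lastCases ?_ (fun i ↦ ?_) i
    · simp [hmul, Finset.smul_sum]
    · simp [hmul]

theorem extendedRelMap_coe (f : Fin k → Pt → ℂ) :
    extendedRelMap P Q ω (fun i ↦ (f i : GermC)) =
      fun i ↦ (((extendedRel P Q ω f i).1 : GermC), ((extendedRel P Q ω f i).2 : GermC)) := by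
  have hsum (F : Fin k → Pt → ℂ) :
      ((fun p ↦ ∑ i, F i p : Pt → ℂ) : GermC) = ∑ i, (F i : GermC) := by
    rw [← Finset.sum_fn]
    exact map_sum (Filter.Germ.coeRingHom (𝓝 (0 : Pt))) F Finset.univ
  funext i
  refine Fin.lastCases ?_ (fun i ↦ ?_) i
  · simp only [extendedRelMap, extendedRel, LinearMap.coe_mk, AddHom.coe_mk, Fin.snoc_last]
    refine Prod.ext ?_ ?_
    · exact congrArg Neg.neg
        (hsum fun i p ↦ f i p * (normalizedForm P Q (ω i)).1 p).symm
    · exact congrArg Neg.neg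
        (hsum fun i p ↦ f i p * (normalizedForm P Q (ω i)).2 p).symm
  · simp only [extendedRelMap, extendedRel, LinearMap.coe_mk, AddHom.coe_mk, Fin.snoc_castSucc]
    rfl

theorem extendedRelMap_injective
    (hω : ∀ᶠ p in 𝓝 (0 : Pt), ∀ i, IsTransverseInfAutAt P Q (ω i) p) :
    Function.Injective (extendedRelMap P Q ω) := by
  intro g h hgh
  funext i
  have hone : ((normalizedForm P Q (ω i)).1 : GermC) * (P : GermC)
      + ((normalizedForm P Q (ω i)).2 : GermC) * (Q : GermC) = 1 :=
    Filter.Germ.coe_eq.2 (hω.mono fun p hp ↦ (hp i).contr_normalizedForm)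
  have hi := congrFun hgh i.castSucc
  simp only [extendedRelMap, LinearMap.coe_mk, AddHom.coe_mk, Fin.snoc_castSucc,
    Prod.mk.injEq] at hi
  linear_combination (P : GermC) * hi.1 + (Q : GermC) * hi.2 - (g i - h i) * hone

theorem map_extendedRelMap_nullSums {U : Set Pt} (hU : U ∈ 𝓝 (0 : Pt))
    (hω : ∀ᶠ p in 𝓝 (0 : Pt), ∀ i, IsTransverseInfAutAt P Q (ω i) p)
    (hPQ : ∀ᶠ p in 𝓝 (0 : Pt), AnalyticAt ℂ P p ∧ AnalyticAt ℂ Q p) :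
    ((nullSums ω).map (extendedRelMap P Q ω) : Set (Fin (k + 1) → GermC × GermC))
      = ARGerms U (Fin.snoc ω (fun p ↦ -Q p, P)) := by
  ext η
  rw [mem_ARGerms_iff hU]
  constructor
  · rintro ⟨_, ⟨f, hf, rfl⟩, rfl⟩
    refine ⟨extendedRel P Q ω f, congrFun (extendedRelMap_coe f), ?_⟩
    filter_upwards [hω, hf] with p hω hf
    exact isAbelianRelOn_extendedRel hω hf.1 hf.2
  · rintro ⟨a, hη, ha⟩
    set f : Fin k → Pt → ℂ := fun i ↦ contr P Q (a i.castSucc) with hfdef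
    have htan : ∀ᶠ p in 𝓝 (0 : Pt), ∀ i : Fin k,
        f i p * (normalizedForm P Q (ω i)).1 p = (a i.castSucc).1 p ∧
        f i p * (normalizedForm P Q (ω i)).2 p = (a i.castSucc).2 p := by
      filter_upwards [hω, ha] with p hω ha i
      refine (hω i).contr_mul_normalizedForm ?_
      simpa only [Fin.snoc_castSucc] using ha.tangent i.castSucc p rfl
    have hlast : ∀ᶠ p in 𝓝 (0 : Pt),
        -∑ i, (a (Fin.castSucc i)).1 p = (a (Fin.last k)).1 p ∧
        -∑ i, (a (Fin.castSucc i)).2 p = (a (Fin.last k)).2 p := by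
      filter_upwards [ha] with p ha
      have h1 := ha.sum_fst p rfl
      have h2 := ha.sum_snd p rfl
      rw [Fin.sum_univ_castSucc] at h1 h2
      exact ⟨neg_eq_of_add_eq_zero_right h1, neg_eq_of_add_eq_zero_right h2⟩
    have hf : IsNullSum ω f := by
      filter_upwards [hω, ha, hPQ, htan.eventually_nhds, hlast] with p hω ha hPQ htan hlast
      have hfan (i) : AnalyticAt ℂ (f i) p :=
        (((ha.analytic i.castSucc).1 p rfl).mul hPQ.1).add
          (((ha.analytic i.castSucc).2 p rfl).mul hPQ.2)
      refine ⟨fun i ↦ ⟨hfan i, ?_⟩, ?_⟩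
      · rw [← (hω i).mul_normalizedForm_closed_iff (hfan i),
          Filter.EventuallyEq.pdy_eq (htan.mono fun q hq ↦ (hq i).1),
          Filter.EventuallyEq.pdx_eq (htan.mono fun q hq ↦ (hq i).2)]
        exact ha.closed i.castSucc p rfl
      · have h := ha.tangent (Fin.last k) p rfl
        simp only [Fin.snoc_last, wedge, ← hlast.1, ← hlast.2] at h
        simp only [hfdef, contr, Finset.sum_add_distrib, ← Finset.sum_mul]
        linear_combination -h
    refine ⟨_, ⟨f, hf, rfl⟩, ?_⟩
    rw [extendedRelMap_coe]
    funext i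
    rw [hη i]
    refine Fin.lastCases ?_ (fun i ↦ ?_) i
    · refine Prod.ext (Filter.Germ.coe_eq.2 ?_) (Filter.Germ.coe_eq.2 ?_) <;>
        filter_upwards [htan, hlast] with p h1 h2
      · simp only [extendedRel, Fin.snoc_last, ← h2.1]
        exact congrArg _ (Finset.sum_congr rfl fun i _ ↦ (h1 i).1)
      · simp only [extendedRel, Fin.snoc_last, ← h2.2]
        exact congrArg _ (Finset.sum_congr rfl fun i _ ↦ (h1 i).2)
    · refine Prod.ext (Filter.Germ.coe_eq.2 ?_) (Filter.Germ.coe_eq.2 ?_) <;>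
        filter_upwards [htan] with p h1
      · simpa only [extendedRel, Fin.snoc_castSucc] using (h1 i).1
      · simpa only [extendedRel, Fin.snoc_castSucc] using (h1 i).2

/-- Adding the foliation of a transverse infinitesimal automorphism to a `k`-web increases the
rank by `k - 1`. -/
theorem finrank_ARGerms_snoc (hk : 1 ≤ k) {U : Set Pt} (hU : U ∈ 𝓝 (0 : Pt))
    (hω : ∀ᶠ p in 𝓝 (0 : Pt), ∀ i, IsTransverseInfAutAt P Q (ω i) p)
    (hPQ : ∀ᶠ p in 𝓝 (0 : Pt), AnalyticAt ℂ P p ∧ AnalyticAt ℂ Q p)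
    (hfin : FiniteDimensional ℂ
      ↥(Submodule.span ℂ (ARGerms U (Fin.snoc ω (fun p => -Q p, P))))) :
    Module.finrank ℂ ↥(Submodule.span ℂ (ARGerms U (Fin.snoc ω (fun p => -Q p, P))))
      = Module.finrank ℂ ↥(Submodule.span ℂ (ARGerms U ω)) + (k - 1) := by
  rw [← map_extendedRelMap_nullSums hU hω hPQ, Submodule.span_eq] at hfin ⊢
  rw [← range_nullSumsDiff hU, Submodule.span_eq]
  have e := Submodule.equivMapOfInjective _ (extendedRelMap_injective hω) (nullSums ω)
  have : FiniteDimensional ℂ (nullSums ω) := e.symm.finiteDimensional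
  rw [← e.finrank_eq, ← finrank_ker_nullSumsDiff (ω := ω) hk,
    LinearMap.finrank_range_add_finrank_ker]

end ExtendedWeb

/-- **second assertion of Theorem 1.** With `W`, `X`, `ω_{k+1} = (−Q,P)`
as in Theorem 1 and `k ≥ 1`, the web `W` has maximal rank
(`dim A(W) = (k−1)(k−2)/2`) if and only if `W ⊠ F_X` has maximal rank
(`dim A(W ⊠ F_X) = k(k−1)/2`). -/
theorem stmt_13 (k : ℕ) (hk : 1 ≤ k) (U : Set Pt) (hU : IsPolydisc U)
    (ω : Fin k → Form1) (hweb : IsWeb ω U) (P Q : Pt → ℂ)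
    (hP : AnalyticOnNhd ℂ P U) (hQ : AnalyticOnNhd ℂ Q U)
    (hinf : IsInfAut P Q ω U) (htr : IsTransverseTo P Q ω U)
    (hX0 : (P 0, Q 0) ≠ (0, 0))
    (hfin : FiniteDimensional ℂ ↥(Submodule.span ℂ (ARGerms U ω)))
    (hfin' : FiniteDimensional ℂ
      ↥(Submodule.span ℂ (ARGerms U (Fin.snoc ω (fun p => -Q p, P))))) :
    Module.finrank ℂ ↥(Submodule.span ℂ (ARGerms U ω)) = (k - 1) * (k - 2) / 2 ↔
      Module.finrank ℂ ↥(Submodule.span ℂ (ARGerms U (Fin.snoc ω (fun p => -Q p, P))))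
        = k * (k - 1) / 2 := by
  have hU0 : U ∈ 𝓝 (0 : Pt) := by
    obtain ⟨r, s, hr, hs, rfl⟩ := hU
    exact prod_mem_nhds (Metric.ball_mem_nhds _ hr) (Metric.ball_mem_nhds _ hs)
  have hω : ∀ᶠ p in 𝓝 (0 : Pt), ∀ i, IsTransverseInfAutAt P Q (ω i) p := by
    filter_upwards [hU0] with p hp i
    exact ⟨hP p hp, hQ p hp, (hweb.analytic i).1 p hp, (hweb.analytic i).2 p hp,
      htr i p hp, hinf i p hp⟩
  have hPQ : ∀ᶠ p in 𝓝 (0 : Pt), AnalyticAt ℂ P p ∧ AnalyticAt ℂ Q p := by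
    filter_upwards [hU0] with p hp using ⟨hP p hp, hQ p hp⟩
  rw [finrank_ARGerms_snoc hk hU0 hω hPQ hfin']
  have hdim : k * (k - 1) / 2 = (k - 1) * (k - 2) / 2 + (k - 1) := by
    obtain ⟨n, rfl⟩ := Nat.exists_eq_add_of_le' hk
    rw [← Nat.add_mul_div_right _ _ two_pos]
    congr 1
    cases n with
    | zero => rfl
    | succ m =>
      simp only [Nat.add_sub_cancel, show m + 1 + 1 - 2 = m by omega]
      ring
  omega
end
end
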